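/- Fix k ∈ N. If P, Q ⊂ R^n are lattice polytopes in the class Q_k, then conv(P ∪ Q) is in the class Q_{k+1}. -/

import Mathlib

open Pointwise MeasureTheory

noncomputable section

/-- Standard dot product on `Fin n → ℝ`. -/
def dotR {n : ℕ} (c x : Fin n → ℝ) : ℝ := ∑ i, c i * x i

/-- The set of minimizers of the linear functional `x ↦ cᵀx` over `P`. -/
def argminSet {n : ℕ} (c : Fin n → ℝ) (P : Set (Fin n → ℝ)) : Set (Fin n → ℝ) :=
  {x ∈ P | ∀ y ∈ P, dotR c x ≤ dotR c y}

/-- A polytope: the convex hull of a nonempty finite set of points. -/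
def IsPolytope {n : ℕ} (P : Set (Fin n → ℝ)) : Prop :=
  ∃ V : Finset (Fin n → ℝ), V.Nonempty ∧ P = convexHull ℝ (V : Set (Fin n → ℝ))

/-- A lattice polytope: the convex hull of a nonempty finite set of integral points. -/
def IsLatticePolytope {n : ℕ} (P : Set (Fin n → ℝ)) : Prop :=
  ∃ V : Finset (Fin n → ℤ), V.Nonempty ∧
    P = convexHull ℝ ((fun v (i : Fin n) => ((v i : ℤ) : ℝ)) '' (V : Set (Fin n → ℤ)))

/-- `F` is a face of `P`: either the empty face or the set of minimizers of a
linear functional over `P`. -/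
def IsFace {n : ℕ} (P F : Set (Fin n → ℝ)) : Prop :=
  F = ∅ ∨ ∃ c : Fin n → ℝ, F = argminSet c P

/-- The dimension of a set: the rank of the direction space of its affine span. -/
def polyDim {n : ℕ} (P : Set (Fin n → ℝ)) : ℕ :=
  Module.finrank ℝ (affineSpan ℝ P).direction

/-- A point all of whose coordinates are integers. -/
def IsIntPt {m : ℕ} (x : Fin m → ℝ) : Prop := ∀ i, ∃ z : ℤ, x i = (z : ℝ)

/-- An affine chart identifying the affine hull of `P` with `ℝ^r` and mapping the induced
lattice of integral points bijectively onto `ℤ^r`. -/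
def IsLatticeChart {n r : ℕ} (P : Set (Fin n → ℝ))
    (φ : (Fin n → ℝ) →ᵃ[ℝ] (Fin r → ℝ)) : Prop :=
  Set.BijOn (fun x => φ x) (affineSpan ℝ P : Set (Fin n → ℝ)) Set.univ ∧
  ∀ x ∈ affineSpan ℝ P, (IsIntPt x ↔ IsIntPt (φ x))

open Classical in
/-- The normalized volume of a (rational) polytope `P`: `r!` times the Euclidean volume of
the image of `P` under a lattice-preserving affine chart of its affine hull (`r = dim P`).
This is well defined (independent of the chart) and integral for lattice polytopes. -/
def normVol {n : ℕ} (P : Set (Fin n → ℝ)) : ℝ :=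
  (Nat.factorial (polyDim P)) *
    (if h : ∃ φ : (Fin n → ℝ) →ᵃ[ℝ] (Fin (polyDim P) → ℝ), IsLatticeChart P φ
      then (volume ((fun x => h.choose x) '' P)).toReal
      else 0)

/-- The normalized volume is an even integer. -/
def EvenVol {n : ℕ} (P : Set (Fin n → ℝ)) : Prop := ∃ m : ℤ, normVol P = 2 * (m : ℝ)

/-- The class `Q_k`: lattice polytopes all of whose faces of dimension at least `2^k`
have even normalized volume. -/
def InQclass (k : ℕ) {n : ℕ} (P : Set (Fin n → ℝ)) : Prop :=
  IsLatticePolytope P ∧ ∀ F, IsFace P F → 2 ^ k ≤ polyDim F → EvenVol F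

/-- The classes `P_k` of lattice polytopes dual to `k`-hidden-layer integral ReLU networks:
`P_0` consists of single lattice points, and `P_{k+1}` consists of finite Minkowski sums of
convex hulls of unions of pairs of polytopes from `P_k`. -/
def InPclass {n : ℕ} : ℕ → Set (Fin n → ℝ) → Prop
  | 0, P => ∃ v : Fin n → ℤ, P = {fun i => ((v i : ℤ) : ℝ)}
  | k+1, P => ∃ (l : ℕ) (Q : Fin l → Set (Fin n → ℝ)), 0 < l ∧
      (∀ i, ∃ Q₁ Q₂ : Set (Fin n → ℝ), InPclass k Q₁ ∧ InPclass k Q₂ ∧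
        Q i = convexHull ℝ (Q₁ ∪ Q₂)) ∧
      P = ∑ i, Q i

/-- A (polyhedral) subdivision of `R`: a finite collection of polytopes covering `R`,
any two of which intersect in a common face. -/
def IsSubdivision {n : ℕ} (R : Set (Fin n → ℝ)) (𝒞 : Finset (Set (Fin n → ℝ))) : Prop :=
  (∀ C ∈ 𝒞, IsPolytope C) ∧
  (⋃ C ∈ 𝒞, C) = R ∧
  ∀ C ∈ 𝒞, ∀ D ∈ 𝒞, IsFace C (C ∩ D) ∧ IsFace D (C ∩ D)

/-- The standard simplex `Δ^n_0 = conv{0, e_1, …, e_n} ⊆ ℝ^n`. -/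
def stdSimplexPoly (n : ℕ) : Set (Fin n → ℝ) :=
  convexHull ℝ ({0} ∪ Set.range (fun i : Fin n => fun j => if j = i then (1 : ℝ) else 0))


/-- cone generated by the vectors `w i`, `i ∈ S`. -/
def wcone {ι E : Type*} [Fintype ι] [AddCommGroup E] [Module ℝ E] (w : ι → E) (S : Finset ι) :
    Set E :=
  {x | ∃ t : ι → ℝ, (∀ i, 0 ≤ t i) ∧ (∀ i, i ∉ S → t i = 0) ∧ ∑ i, t i • w i = x}

lemma wcone_mono {ι E : Type*} [Fintype ι] [AddCommGroup E] [Module ℝ E] (w : ι → E)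
    {S T : Finset ι} (h : S ⊆ T) : wcone w S ⊆ wcone w T := by
  rintro x ⟨t, h0, h1, h2⟩
  exact ⟨t, h0, fun i hi => h1 i (fun h' => hi (h h')), h2⟩

lemma mem_span_of_sum {ι E : Type*} [Fintype ι] [AddCommGroup E] [Module ℝ E] (w : ι → E)
    (S : Finset ι) (t : ι → ℝ) (h : ∀ i, i ∉ S → t i = 0) :
    ∑ i, t i • w i ∈ Submodule.span ℝ (w '' S) := by
  refine Submodule.sum_mem _ fun i _ => ?_
  by_cases hi : i ∈ S
  · exact Submodule.smul_mem _ _ (Submodule.subset_span ⟨i, hi, rfl⟩)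
  · simp [h i hi]

lemma wcone_subset_span {ι E : Type*} [Fintype ι] [AddCommGroup E] [Module ℝ E] (w : ι → E)
    (S : Finset ι) : wcone w S ⊆ Submodule.span ℝ (w '' S) := by
  rintro x ⟨t, h0, h1, rfl⟩
  exact mem_span_of_sum w S t h1

open Filter Topology in
lemma exists_small {ι : Type*} [Fintype ι] (t δ : ι → ℝ) (ht : ∀ i, 0 ≤ t i)
    (hδ : ∀ i, t i = 0 → 0 ≤ δ i) : ∃ ε : ℝ, 0 < ε ∧ ∀ i, 0 ≤ t i + ε * δ i := by
  have : ∀ᶠ ε : ℝ in 𝓝[>] 0, ∀ i, 0 ≤ t i + ε * δ i := by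
    rw [eventually_all]
    intro i
    rcases (ht i).eq_or_lt with h | h
    · filter_upwards [self_mem_nhdsWithin] with ε hε
      rw [← h, zero_add]
      exact mul_nonneg (le_of_lt hε) (hδ i h.symm)
    · have h1 : Tendsto (fun ε : ℝ => t i + ε * δ i) (𝓝[>] 0) (𝓝 (t i + 0 * δ i)) := by
        apply Tendsto.mono_left _ nhdsWithin_le_nhds
        exact Continuous.tendsto (by fun_prop) 0
      have h2 := h1.eventually (lt_mem_nhds (show (0:ℝ) < t i + 0 * δ i by simpa using h))
      exact h2.mono fun _ => le_of_lt
  obtain ⟨ε, h1, h2⟩ := (this.and self_mem_nhdsWithin).exists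
  exact ⟨ε, h2, h1⟩

/-- Dual solution. -/
lemma exists_dual_of_opt {ι E : Type*} [Fintype ι] [AddCommGroup E] [Module ℝ E]
    (w : ι → E) (β : ι → ℝ) (S : Finset ι) (t : ι → ℝ) (ht : ∀ i, 0 ≤ t i)
    (htS : ∀ i, i ∉ S → t i = 0)
    (hspan : Submodule.span ℝ (w '' {i | 0 < t i}) = ⊤)
    (hopt : ∀ s : ι → ℝ, (∀ i, 0 ≤ s i) → (∀ i, i ∉ S → s i = 0) →
      ∑ i, s i • w i = ∑ i, t i • w i → ∑ i, t i * β i ≤ ∑ i, s i * β i) :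
    ∃ l : E →ₗ[ℝ] ℝ, (∀ i ∈ S, l (w i) ≤ β i) ∧ ∀ i, 0 < t i → l (w i) = β i := by
  classical
  have key : ∀ δ : ι → ℝ, (∀ i, i ∉ S → δ i = 0) → (∀ i, t i = 0 → 0 ≤ δ i) →
      ∑ i, δ i • w i = 0 → 0 ≤ ∑ i, δ i * β i := by
    intro δ h1 h2 h3
    obtain ⟨ε, hε, h4⟩ := exists_small t δ ht h2
    have := hopt (fun i => t i + ε * δ i) h4 (fun i hi => by simp [h1 i hi, htS i hi])
      (by simp only [add_smul, Finset.sum_add_distrib, mul_smul, ← Finset.smul_sum, h3]; simp)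
    simp only [add_mul, Finset.sum_add_distrib, mul_assoc, ← Finset.mul_sum] at this
    have h5 : 0 ≤ ε * ∑ i, δ i * β i := by linarith
    exact nonneg_of_mul_nonneg_right h5 hε
  obtain ⟨κ, a, ainj, aspan, alin⟩ := exists_linearIndependent' ℝ (fun i : {i | 0 < t i} => w i)
  have : Finite κ := Finite.of_injective a ainj
  have := Fintype.ofFinite κ
  have hr : Set.range (fun i : {i | 0 < t i} => w i) = w '' {i | 0 < t i} := by
    rw [Set.image_eq_range]
  rw [hr, hspan] at aspan
  let b : Module.Basis κ ℝ E := Module.Basis.mk alin aspan.ge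
  have hb : ∀ k, b k = w (a k) := fun k => by simp [b]
  let l : E →ₗ[ℝ] ℝ := b.constr ℝ (fun k => β (a k))
  have hl : ∀ k, l (w (a k)) = β (a k) := fun k => by rw [← hb, b.constr_basis]
  have hpos : ∀ k, 0 < t (a k) := fun k => (a k).2
  have haS : ∀ k, (a k : ι) ∈ S := fun k => by
    by_contra h
    exact (hpos k).ne' (htS _ h)
  let δ : ι → ι → ℝ := fun j i => (if i = j then 1 else 0) -
    ∑ k, if (a k : ι) = i then b.repr (w j) k else 0
  have hsum : ∀ (j : ι), ∑ i, δ j i • w i = 0 := by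
    intro j
    simp only [δ, sub_smul, Finset.sum_sub_distrib, Finset.sum_smul, ite_smul, one_smul, zero_smul]
    rw [Finset.sum_comm]
    simp only [Finset.sum_ite_eq, Finset.sum_ite_eq', Finset.mem_univ, if_true]
    have := b.sum_repr (w j)
    simp only [hb] at this
    rw [this, sub_self]
  have hcost : ∀ (j : ι), ∑ i, δ j i * β i = β j - l (w j) := by
    intro j
    simp only [δ, sub_mul, Finset.sum_sub_distrib, Finset.sum_mul, ite_mul, one_mul, zero_mul]
    rw [Finset.sum_comm]
    simp only [Finset.sum_ite_eq, Finset.sum_ite_eq', Finset.mem_univ, if_true]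
    congr 1
    conv_rhs => rw [← b.sum_repr (w j), map_sum]
    refine Finset.sum_congr rfl fun k _ => ?_
    rw [map_smul, hb, hl, smul_eq_mul]
  have hz : ∀ i, (t i = 0 ∨ i ∉ S) → ∑ k, (if (a k : ι) = i then b.repr (w i) k else 0) = 0 ∧
      ∀ j, ∑ k, (if (a k : ι) = i then b.repr (w j) k else 0) = 0 := by
    intro i hi
    have : ∀ k, (a k : ι) ≠ i := by
      rintro k rfl
      rcases hi with hi | hi
      · exact (hpos k).ne' hi
      · exact hi (haS k)
    simp [this]
  refine ⟨l, ?_, ?_⟩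
  · intro j hj
    have := key (δ j) ?_ ?_ (hsum j)
    · rw [hcost] at this; linarith
    · intro i hi
      simp only [δ, (hz i (Or.inr hi)).2 j]
      rw [if_neg (by rintro rfl; exact hi hj)]; simp
    · intro i hi
      simp only [δ, (hz i (Or.inl hi)).2 j]
      split_ifs <;> simp
  · intro j hj
    have hjS : j ∈ S := by
      by_contra h
      exact hj.ne' (htS _ h)
    have h1 := key (δ j) ?_ ?_ (hsum j)
    have h2 := key (fun i => - δ j i) ?_ ?_ (by simp [hsum j])
    · simp only [neg_mul, Finset.sum_neg_distrib] at h2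
      rw [hcost] at h1 h2; linarith
    · intro i hi
      simp only [δ, (hz i (Or.inr hi)).2 j]
      rw [if_neg (by rintro rfl; exact hi hjS)]; simp
    · intro i hi
      simp only [δ, (hz i (Or.inl hi)).2 j]
      rw [if_neg (by rintro rfl; exact hj.ne' hi)]; simp
    · intro i hi
      simp only [δ, (hz i (Or.inr hi)).2 j]
      rw [if_neg (by rintro rfl; exact hi hjS)]; simp
    · intro i hi
      simp only [δ, (hz i (Or.inl hi)).2 j]
      split_ifs <;> simp

/-- full-dimensional cells of the regular subdivision. -/
def IsCell {ι E : Type*} [Fintype ι] [AddCommGroup E] [Module ℝ E] (w : ι → E) (β : ι → ℝ)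
    (S T : Finset ι) : Prop :=
  Submodule.span ℝ (w '' T) = ⊤ ∧ ∃ l : E →ₗ[ℝ] ℝ, (∀ i ∈ S, l (w i) ≤ β i) ∧
    ∀ i, i ∈ T ↔ (i ∈ S ∧ l (w i) = β i)

def Generic {ι E : Type*} [Fintype ι] [AddCommGroup E] [Module ℝ E] (w : ι → E) (x : E) : Prop :=
  ∀ T : Set ι, x ∈ Submodule.span ℝ (w '' T) → Submodule.span ℝ (w '' T) = ⊤

lemma mem_span_supp {ι E : Type*} [Fintype ι] [AddCommGroup E] [Module ℝ E] (w : ι → E)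
    (t : ι → ℝ) (ht : ∀ i, 0 ≤ t i) :
    ∑ i, t i • w i ∈ Submodule.span ℝ (w '' {i | 0 < t i}) := by
  refine Submodule.sum_mem _ fun i _ => ?_
  rcases (ht i).eq_or_lt with h | h
  · simp [← h]
  · exact Submodule.smul_mem _ _ (Submodule.subset_span ⟨i, h, rfl⟩)

lemma cell_unique {ι E : Type*} [Fintype ι] [AddCommGroup E] [Module ℝ E]
    (w : ι → E) (β : ι → ℝ) (S T T' : Finset ι) (hT : IsCell w β S T) (hT' : IsCell w β S T')
    (x : E) (hx : Generic w x) (h : x ∈ wcone w T) (h' : x ∈ wcone w T') : T = T' := by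
  obtain ⟨-, l, hl, hlT⟩ := hT
  obtain ⟨-, l', hl', hlT'⟩ := hT'
  obtain ⟨t, t0, t1, rfl⟩ := h
  obtain ⟨s, s0, s1, hs⟩ := h'
  have e1 : l (∑ i, t i • w i) = ∑ i, t i * β i := by
    rw [map_sum]; refine Finset.sum_congr rfl fun i _ => ?_
    by_cases hi : i ∈ T
    · simp [((hlT i).1 hi).2]
    · simp [t1 i hi]
  have e2 : l' (∑ i, t i • w i) = ∑ i, s i * β i := by
    rw [← hs, map_sum]; refine Finset.sum_congr rfl fun i _ => ?_
    by_cases hi : i ∈ T'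
    · simp [((hlT' i).1 hi).2]
    · simp [s1 i hi]
  have i1 : ∀ i, s i * l (w i) ≤ s i * β i := fun i => by
    by_cases hi : i ∈ T'
    · exact mul_le_mul_of_nonneg_left (hl i ((hlT' i).1 hi).1) (s0 i)
    · simp [s1 i hi]
  have i2 : ∀ i, t i * l' (w i) ≤ t i * β i := fun i => by
    by_cases hi : i ∈ T
    · exact mul_le_mul_of_nonneg_left (hl' i ((hlT i).1 hi).1) (t0 i)
    · simp [t1 i hi]
  have e3 : l (∑ i, t i • w i) = ∑ i, s i * l (w i) := by
    rw [← hs, map_sum]; simp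
  have e4 : l' (∑ i, t i • w i) = ∑ i, t i * l' (w i) := by
    rw [map_sum]; simp
  have j1 : ∑ i, s i * l (w i) ≤ ∑ i, s i * β i := Finset.sum_le_sum fun i _ => i1 i
  have j2 : ∑ i, t i * l' (w i) ≤ ∑ i, t i * β i := Finset.sum_le_sum fun i _ => i2 i
  have e5 : ∑ i, s i * l (w i) = ∑ i, s i * β i := by linarith
  rw [Finset.sum_eq_sum_iff_of_le (fun i _ => i1 i)] at e5
  have hll : l = l' := by
    have hsp := hx {i | 0 < s i} (by rw [← hs]; exact mem_span_supp w s s0)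
    apply LinearMap.ext_on hsp
    rintro _ ⟨i, hi, rfl⟩
    have hi' : i ∈ T' := by
      by_contra h
      exact (ne_of_gt hi) (s1 i h)
    rw [((hlT' i).1 hi').2]
    exact mul_left_cancel₀ (ne_of_gt hi) (e5 i (Finset.mem_univ _))
  ext i
  rw [hlT, hlT', hll]

lemma cell_exists {ι E : Type*} [Fintype ι] [NormedAddCommGroup E] [NormedSpace ℝ E]
    (w : ι → E) (β : ι → ℝ) (S : Finset ι) (h : E →ₗ[ℝ] ℝ) (hh : ∀ i ∈ S, h (w i) = 1)
    (x : E) (hx : Generic w x) (hxS : x ∈ wcone w S) :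
    ∃ T ⊆ S, IsCell w β S T ∧ x ∈ wcone w T := by
  classical
  let K : Set (ι → ℝ) := {t | (∀ i, 0 ≤ t i) ∧ (∀ i, i ∉ S → t i = 0) ∧ ∑ i, t i • w i = x}
  have hb : K ⊆ Set.Icc 0 (fun _ => h x) := by
    rintro t ⟨h0, h1, h2⟩
    refine ⟨fun i => h0 i, fun i => ?_⟩
    have : h x = ∑ i, t i := by
      rw [← h2, map_sum]
      refine Finset.sum_congr rfl fun i _ => ?_
      by_cases hi : i ∈ S
      · simp [hh i hi]
      · simp [h1 i hi]
    rw [this]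
    exact Finset.single_le_sum (fun i _ => h0 i) (Finset.mem_univ i)
  have hc : IsClosed K := by
    have e : K = (⋂ i, {t | 0 ≤ t i}) ∩ ((⋂ i, {t | i ∉ S → t i = 0}) ∩
        {t | ∑ i, t i • w i = x}) := by
      ext t; simp [K]
    rw [e]
    refine (isClosed_iInter fun i => isClosed_le (by fun_prop) (by fun_prop)).inter
      ((isClosed_iInter fun i => ?_).inter (isClosed_eq (by fun_prop) (by fun_prop)))
    by_cases hi : i ∈ S
    · simp [hi]
    · simp only [hi, not_false_eq_true, forall_const]
      exact isClosed_eq (by fun_prop) (by fun_prop)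
  have hK : IsCompact K := isCompact_Icc.of_isClosed_subset hc hb
  obtain ⟨t, ⟨t0, t1, t2⟩, htm⟩ := hK.exists_isMinOn hxS
    (f := fun t => ∑ i, t i * β i) (by fun_prop)
  have hsp := hx {i | 0 < t i} (by rw [← t2]; exact mem_span_supp w t t0)
  obtain ⟨l, l1, l2⟩ := exists_dual_of_opt w β S t t0 t1 hsp
    (fun s s0 s1 s2 => htm ⟨s0, s1, s2.trans t2⟩)
  have hsub : {i | 0 < t i} ⊆ ((S.filter fun i => l (w i) = β i : Finset ι) : Set ι) := by
    intro i hi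
    simp only [Finset.coe_filter, Set.mem_ofPred_eq]
    refine ⟨?_, l2 i hi⟩
    by_contra h
    exact (ne_of_gt hi) (t1 i h)
  refine ⟨S.filter (fun i => l (w i) = β i), Finset.filter_subset _ _, ⟨?_, l, l1, ?_⟩,
    t, t0, ?_, t2⟩
  · rw [eq_top_iff, ← hsp]
    exact Submodule.span_mono (Set.image_mono hsub)
  · intro i; simp
  · intro i hi
    by_contra h
    exact hi (hsub (lt_of_le_of_ne (t0 i) (Ne.symm h)))

lemma measurableSet_wcone {ι E : Type*} [Fintype ι] [NormedAddCommGroup E] [NormedSpace ℝ E]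
    [MeasurableSpace E] [BorelSpace E] (w : ι → E) (S : Finset ι) :
    MeasurableSet (wcone w S) := by
  have e : wcone w S = (fun t : ι → ℝ => ∑ i, t i • w i) ''
      {t | (∀ i, 0 ≤ t i) ∧ (∀ i, i ∉ S → t i = 0)} := by
    ext x; simp [wcone, and_assoc]
  have hc : IsClosed {t : ι → ℝ | (∀ i, 0 ≤ t i) ∧ (∀ i, i ∉ S → t i = 0)} := by
    have e : {t : ι → ℝ | (∀ i, 0 ≤ t i) ∧ (∀ i, i ∉ S → t i = 0)} =
        (⋂ i, {t | 0 ≤ t i}) ∩ (⋂ i, {t | i ∉ S → t i = 0}) := by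
      ext t; simp
    rw [e]
    refine (isClosed_iInter fun i => isClosed_le (by fun_prop) (by fun_prop)).inter
      (isClosed_iInter fun i => ?_)
    by_cases hi : i ∈ S
    · simp [hi]
    · simp only [hi, not_false_eq_true, forall_const]
      exact isClosed_eq (by fun_prop) (by fun_prop)
  have h2 : IsSigmaCompact (wcone w S) := by
    rw [e]
    refine IsSigmaCompact.image (by fun_prop) ?_
    exact isSigmaCompact_univ.of_isClosed_subset hc (Set.subset_univ _)
  obtain ⟨K, hK, hK2⟩ := h2
  rw [← hK2]
  exact MeasurableSet.iUnion fun n => (hK n).measurableSet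

lemma ae_generic {ι E : Type*} [Fintype ι] [NormedAddCommGroup E] [NormedSpace ℝ E]
    [MeasurableSpace E] [BorelSpace E] [FiniteDimensional ℝ E] (μ : Measure E)
    [μ.IsAddHaarMeasure] (w : ι → E) : ∀ᵐ x ∂μ, Generic w x := by
  unfold Generic
  rw [ae_all_iff]
  intro T
  by_cases hT : Submodule.span ℝ (w '' T) = ⊤
  · simp [hT]
  · simp only [hT, imp_false]
    have := Measure.addHaar_submodule μ _ hT
    rw [ae_iff]
    simpa using this

open Classical in
theorem lintegral_subdivision {ι E : Type*} [Fintype ι] [NormedAddCommGroup E] [NormedSpace ℝ E]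
    [MeasurableSpace E] [BorelSpace E] [FiniteDimensional ℝ E] (μ : Measure E)
    [μ.IsAddHaarMeasure] (w : ι → E) (β : ι → ℝ) (S : Finset ι) (h : E →ₗ[ℝ] ℝ)
    (hh : ∀ i ∈ S, h (w i) = 1) (f : E → ENNReal) (hf : Measurable f) :
    ∫⁻ x, (wcone w S).indicator f x ∂μ =
      ∑ T ∈ S.powerset.filter (fun T => IsCell w β S T), ∫⁻ x, (wcone w T).indicator f x ∂μ := by
  rw [← lintegral_finsetSum _ fun T _ => hf.indicator (measurableSet_wcone w T)]
  apply lintegral_congr_ae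
  filter_upwards [ae_generic μ w] with x hx
  by_cases hxS : x ∈ wcone w S
  · obtain ⟨T, hTS, hT, hxT⟩ := cell_exists w β S h hh x hx hxS
    rw [Finset.sum_eq_single T]
    · simp [hxS, hxT]
    · intro T' hT' hne
      rw [Set.indicator_of_notMem]
      intro hxT'
      exact hne (cell_unique w β S T' T (Finset.mem_filter.1 hT').2 hT x hx hxT' hxT)
    · intro hn
      exact absurd (by simp [hTS, hT]) hn
  · rw [Set.indicator_of_notMem hxS]
    symm
    apply Finset.sum_eq_zero
    intro T hT
    rw [Set.indicator_of_notMem]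
    intro hx'
    exact hxS (wcone_mono w (by simpa using (Finset.mem_filter.1 hT).1) hx')

def LChart {N d : ℕ} (W : Submodule ℝ (Fin N → ℝ)) (ψ : (Fin d → ℝ) →ₗ[ℝ] (Fin N → ℝ)) : Prop :=
  Function.Injective ψ ∧ LinearMap.range ψ = W ∧ ∀ y, IsIntPt (ψ y) ↔ IsIntPt y

def gexp {E : Type*} [AddCommGroup E] [Module ℝ E] (h : E →ₗ[ℝ] ℝ) (x : E) : ENNReal :=
  ENNReal.ofReal (Real.exp (-(h x)))

def cvol {κ : Type*} [Fintype κ] {E : Type*} [AddCommGroup E] [Module ℝ E] (h : E →ₗ[ℝ] ℝ)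
    (ψ : (κ → ℝ) →ₗ[ℝ] E) (C : Set E) : ENNReal :=
  ∫⁻ y, C.indicator (gexp h) (ψ y)

lemma int_det {d : ℕ} (L : (Fin d → ℝ) →ₗ[ℝ] (Fin d → ℝ))
    (hL : ∀ j, IsIntPt (L (Pi.single j 1))) : ∃ z : ℤ, LinearMap.det L = z := by
  choose M hM using hL
  refine ⟨Matrix.det (Matrix.of fun i j => M j i), ?_⟩
  rw [← LinearMap.det_toMatrix']
  have : LinearMap.toMatrix' L = (Int.castRingHom ℝ).mapMatrix (Matrix.of fun i j => M j i) := by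
    ext i j
    simp [LinearMap.toMatrix'_apply, ← hM]
  rw [this, ← RingHom.map_det]
  simp

lemma det_lemma {N d : ℕ} {κ : Type*} [Fintype κ] [DecidableEq κ]
    (ψ : (Fin d → ℝ) →ₗ[ℝ] (Fin N → ℝ)) (ψ' : (κ → ℝ) →ₗ[ℝ] (Fin N → ℝ))
    (hψ : Function.Injective ψ) (hψi : ∀ y, IsIntPt (ψ y) → IsIntPt y)
    (hψ' : Function.Injective ψ') (hψi' : ∀ j, IsIntPt (ψ' (Pi.single j 1)))
    (hr : LinearMap.range ψ' = LinearMap.range ψ) :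
    ∃ m : ℕ, ∀ f : (Fin N → ℝ) → ENNReal, ∫⁻ y, f (ψ y) = m * ∫⁻ z, f (ψ' z) := by
  let T : (κ → ℝ) ≃ₗ[ℝ] (Fin d → ℝ) := (LinearEquiv.ofInjective ψ' hψ').trans
    ((LinearEquiv.ofEq _ _ hr).trans (LinearEquiv.ofInjective ψ hψ).symm)
  have hT : ∀ z, ψ (T z) = ψ' z := by
    intro z
    have := LinearEquiv.apply_symm_apply (LinearEquiv.ofInjective ψ hψ)
      ((LinearEquiv.ofEq _ _ hr) (LinearEquiv.ofInjective ψ' hψ' z))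
    have h2 := congrArg Subtype.val this
    simpa [T] using h2
  have hTi : ∀ j, IsIntPt (T (Pi.single j 1)) := fun j => hψi _ (by rw [hT]; exact hψi' j)
  have hcard : Fintype.card κ = d := by
    simpa using T.finrank_eq
  let e : Fin d ≃ κ := (Fintype.equivFinOfCardEq hcard).symm
  let R : (Fin d → ℝ) ≃ₗ[ℝ] (κ → ℝ) := LinearEquiv.funCongrLeft ℝ ℝ e.symm
  have hR : (R : (Fin d → ℝ) → (κ → ℝ)) = MeasurableEquiv.piCongrLeft (fun _ : κ => ℝ) e := by
    funext x
    ext k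
    obtain ⟨i, rfl⟩ := e.surjective k
    simp [R, LinearEquiv.funCongrLeft, MeasurableEquiv.piCongrLeft]
  have hRs : ∀ i, R (Pi.single i 1) = Pi.single (e i) 1 := by
    intro i
    ext k
    obtain ⟨j, rfl⟩ := e.surjective k
    simp [R, LinearEquiv.funCongrLeft, Pi.single_apply]
  have hRm : MeasurePreserving (MeasurableEquiv.piCongrLeft (fun _ : κ => ℝ) e) :=
    volume_measurePreserving_piCongrLeft (fun _ : κ => ℝ) e
  let L : (Fin d → ℝ) ≃ₗ[ℝ] (Fin d → ℝ) := R.trans T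
  obtain ⟨z, hz⟩ := int_det L.toLinearMap (fun j => by
    have : (L.toLinearMap (Pi.single j 1)) = T (Pi.single (e j) 1) := by
      rw [← hRs]; rfl
    rw [this]; exact hTi _)
  have hdet : LinearMap.det L.toLinearMap ≠ 0 := (LinearEquiv.isUnit_det' L).ne_zero
  have hmap := Measure.map_linearMap_addHaar_eq_smul_addHaar (volume : Measure (Fin d → ℝ)) hdet
  refine ⟨z.natAbs, fun f => ?_⟩
  have h1 : ∫⁻ z, f (ψ' z) = ∫⁻ y, f (ψ (L y)) := by
    rw [← hRm.lintegral_comp_emb (MeasurableEquiv.measurableEmbedding _)]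
    refine lintegral_congr fun y => ?_
    rw [← hT, ← hR]; rfl
  let Lm : (Fin d → ℝ) ≃ᵐ (Fin d → ℝ) := L.toContinuousLinearEquiv.toHomeomorph.toMeasurableEquiv
  have h2 : ∫⁻ y, f (ψ (L y)) = ∫⁻ y, f (ψ y) ∂(Measure.map L.toLinearMap volume) := by
    have := lintegral_map_equiv (fun y => f (ψ y)) Lm (μ := volume)
    exact this.symm
  rw [h1, h2, hmap, lintegral_smul_measure, smul_eq_mul, ← mul_assoc, hz]
  have hz0 : z ≠ 0 := by
    rintro rfl
    exact hdet (by rw [hz]; simp)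
  have : ((z.natAbs : ℕ) : ENNReal) * ENNReal.ofReal |(z : ℝ)⁻¹| = 1 := by
    rw [← ENNReal.ofReal_natCast, ← ENNReal.ofReal_mul (by positivity), ← ENNReal.ofReal_one]
    congr 1
    rw [Nat.cast_natAbs, abs_inv]
    push_cast
    apply mul_inv_cancel₀
    simpa using hz0
  rw [this, one_mul]

lemma isInt_single {m : ℕ} (j : Fin m) : IsIntPt (Pi.single j (1:ℝ) : Fin m → ℝ) := by
  intro i
  by_cases h : i = j
  · subst h; exact ⟨1, by simp⟩
  · exact ⟨0, by simp [h]⟩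

def intLat (N : ℕ) (W : Submodule ℝ (Fin N → ℝ)) : Submodule ℤ W where
  carrier := {x | IsIntPt (x : Fin N → ℝ)}
  add_mem' := by
    intro x y hx hy i
    obtain ⟨a, ha⟩ := hx i
    obtain ⟨b, hb⟩ := hy i
    exact ⟨a + b, by simp [ha, hb]⟩
  zero_mem' := fun i => ⟨0, by simp⟩
  smul_mem' := by
    intro c x hx i
    obtain ⟨a, ha⟩ := hx i
    exact ⟨c * a, by simp [ha]⟩

lemma exists_LChart {N : ℕ} (W : Submodule ℝ (Fin N → ℝ)) (s : Set (Fin N → ℝ))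
    (hs : ∀ x ∈ s, IsIntPt x) (hW : Submodule.span ℝ s = W) :
    ∃ ψ : (Fin (Module.finrank ℝ W) → ℝ) →ₗ[ℝ] (Fin N → ℝ), LChart W ψ := by
  have hd : DiscreteTopology (intLat N W) := by
    refine DiscreteTopology.of_forall_le_dist (r := 1) one_pos ?_
    rintro ⟨⟨x, hxW⟩, hx⟩ ⟨⟨y, hyW⟩, hy⟩ hne
    have hne' : x ≠ y := by
      rintro rfl; exact hne rfl
    obtain ⟨i, hi⟩ := Function.ne_iff.1 hne'
    obtain ⟨a, ha⟩ := hx i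
    obtain ⟨b, hb⟩ := hy i
    have h1 : dist (x i) (y i) ≤ dist x y := dist_le_pi_dist x y i
    refine le_trans ?_ h1
    change x i = a at ha
    change y i = b at hb
    rw [ha, hb] at hi ⊢
    have hab : a - b ≠ 0 := sub_ne_zero.2 (fun h => hi (by rw [h]))
    rw [Real.dist_eq]
    exact_mod_cast Int.one_le_abs hab
  have hz : IsZLattice ℝ (intLat N W) := by
    constructor
    rw [eq_top_iff]
    rintro ⟨x, hx⟩ -
    have : x ∈ Submodule.map W.subtype (Submodule.span ℝ (intLat N W : Set W)) := by
      rw [Submodule.map_span]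
      rw [← hW] at hx
      refine Submodule.span_mono ?_ hx
      intro y hy
      exact ⟨⟨y, hW ▸ Submodule.subset_span hy⟩, hs y hy, rfl⟩
    obtain ⟨y, hy, rfl⟩ := this
    exact hy
  have : Module.Finite ℤ (intLat N W) := ZLattice.module_finite ℝ _
  have : Module.Free ℤ (intLat N W) := ZLattice.module_free ℝ _
  have hrk := ZLattice.rank ℝ (intLat N W)
  let b0 : Module.Basis (Fin (Module.finrank ℝ W)) ℤ (intLat N W) :=
    (Module.finBasis ℤ (intLat N W)).reindex (finCongr hrk)
  let b := b0.ofZLatticeBasis ℝ (intLat N W)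
  have hspan : Submodule.span ℤ (Set.range b) = intLat N W := b0.ofZLatticeBasis_span ℝ
  refine ⟨W.subtype ∘ₗ b.equivFun.symm.toLinearMap, ?_, ?_, ?_⟩
  · intro x y hxy
    exact b.equivFun.symm.injective (Subtype.ext hxy)
  · rw [LinearMap.range_comp]
    simp
  · intro y
    have h1 := b.mem_span_iff_repr_mem ℤ (b.equivFun.symm y)
    rw [hspan] at h1
    have h2 : IsIntPt ((W.subtype ∘ₗ b.equivFun.symm.toLinearMap) y) ↔
      b.equivFun.symm y ∈ intLat N W := Iff.rfl
    rw [h2, h1]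
    have : ∀ i, b.repr (b.equivFun.symm y) i = y i := fun i => by
      rw [← b.equivFun_apply, LinearEquiv.apply_symm_apply]
    simp only [this]
    refine forall_congr' fun i => ?_
    simp [eq_comm]

lemma measurable_gexp {E : Type*} [NormedAddCommGroup E] [NormedSpace ℝ E] [FiniteDimensional ℝ E]
    [MeasurableSpace E] [BorelSpace E] (h : E →ₗ[ℝ] ℝ) : Measurable (gexp h) := by
  unfold gexp
  have : Continuous h := h.continuous_of_finiteDimensional
  have : Measurable h := this.measurable
  fun_prop

lemma wcone_add {ι E : Type*} [Fintype ι] [AddCommGroup E] [Module ℝ E] [DecidableEq ι]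
    (w : ι → E) (F G : Finset ι)
    (hd : Disjoint (Submodule.span ℝ (w '' F)) (Submodule.span ℝ (w '' G)))
    (x y : E) (hx : x ∈ Submodule.span ℝ (w '' F)) (hy : y ∈ Submodule.span ℝ (w '' G)) :
    x + y ∈ wcone w (F ∪ G) ↔ x ∈ wcone w F ∧ y ∈ wcone w G := by
  constructor
  · rintro ⟨t, t0, t1, t2⟩
    let a : ι → ℝ := fun i => if i ∈ F then t i else 0
    let b : ι → ℝ := fun i => if i ∈ F then 0 else t i
    have ha : ∀ i, i ∉ F → a i = 0 := fun i hi => by simp [a, hi]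
    have hb : ∀ i, i ∉ G → b i = 0 := fun i hi => by
      by_cases h : i ∈ F
      · simp [b, h]
      · simp only [b, h, if_false]; exact t1 i (by simp [h, hi])
    have hs : ∑ i, a i • w i + ∑ i, b i • w i = x + y := by
      rw [← Finset.sum_add_distrib, ← t2]
      refine Finset.sum_congr rfl fun i _ => ?_
      by_cases h : i ∈ F <;> simp [a, b, h]
    have h1 := mem_span_of_sum w F a ha
    have h2 := mem_span_of_sum w G b hb
    have h3 : ∑ i, a i • w i - x = y - ∑ i, b i • w i := by
      rw [sub_eq_sub_iff_add_eq_add, hs, add_comm]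
    have h4 : ∑ i, a i • w i - x = 0 := by
      refine Submodule.disjoint_def.1 hd _ (Submodule.sub_mem _ h1 hx) ?_
      rw [h3]; exact Submodule.sub_mem _ hy h2
    refine ⟨⟨a, fun i => ?_, ha, sub_eq_zero.1 h4⟩, ⟨b, fun i => ?_, hb, ?_⟩⟩
    · simp only [a]; split_ifs <;> simp [t0]
    · simp only [b]; split_ifs <;> simp [t0]
    · rw [h4] at h3; exact (sub_eq_zero.1 h3.symm).symm
  · rintro ⟨⟨a, a0, a1, rfl⟩, ⟨b, b0, b1, rfl⟩⟩
    refine ⟨a + b, fun i => add_nonneg (a0 i) (b0 i), fun i hi => ?_, ?_⟩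
    · simp only [Finset.mem_union, not_or] at hi
      simp [a1 i hi.1, b1 i hi.2]
    · simp [add_smul, Finset.sum_add_distrib]

def sumMap {E : Type*} [AddCommGroup E] [Module ℝ E] {a b : ℕ} (ψ : (Fin a → ℝ) →ₗ[ℝ] E)
    (χ : (Fin b → ℝ) →ₗ[ℝ] E) : (Fin a ⊕ Fin b → ℝ) →ₗ[ℝ] E :=
  ψ ∘ₗ LinearMap.funLeft ℝ ℝ Sum.inl + χ ∘ₗ LinearMap.funLeft ℝ ℝ Sum.inr

lemma cvol_join {ι : Type*} [Fintype ι] [DecidableEq ι] {N d a b : ℕ} (h : (Fin N → ℝ) →ₗ[ℝ] ℝ)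
    (w : ι → Fin N → ℝ) (F G : Finset ι)
    (hd : Disjoint (Submodule.span ℝ (w '' F)) (Submodule.span ℝ (w '' G)))
    (ψ : (Fin d → ℝ) →ₗ[ℝ] (Fin N → ℝ)) (hψ : LChart (Submodule.span ℝ (w '' (F ∪ G : Finset ι))) ψ)
    (ψF : (Fin a → ℝ) →ₗ[ℝ] (Fin N → ℝ)) (hF : LChart (Submodule.span ℝ (w '' F)) ψF)
    (ψG : (Fin b → ℝ) →ₗ[ℝ] (Fin N → ℝ)) (hG : LChart (Submodule.span ℝ (w '' G)) ψG) :
    a + b = d ∧ ∃ m : ℕ, cvol h ψ (wcone w (F ∪ G)) =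
      m * (cvol h ψF (wcone w F) * cvol h ψG (wcone w G)) := by
  have hsF : ∀ y, ψF y ∈ Submodule.span ℝ (w '' F) := fun y => by rw [← hF.2.1]; exact ⟨y, rfl⟩
  have hsG : ∀ y, ψG y ∈ Submodule.span ℝ (w '' G) := fun y => by rw [← hG.2.1]; exact ⟨y, rfl⟩
  have hinj : Function.Injective (sumMap ψF ψG) := by
    rw [← LinearMap.ker_eq_bot, LinearMap.ker_eq_bot']
    intro z hz
    have hz' : ψF (z ∘ Sum.inl) + ψG (z ∘ Sum.inr) = 0 := hz
    have h1 : ψF (z ∘ Sum.inl) = 0 := by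
      refine Submodule.disjoint_def.1 hd _ (hsF _) ?_
      rw [eq_neg_of_add_eq_zero_left hz']
      exact Submodule.neg_mem _ (hsG _)
    have h2 : ψG (z ∘ Sum.inr) = 0 := by rw [h1, zero_add] at hz'; exact hz'
    have h3 := (map_eq_zero_iff ψF hF.1).1 h1
    have h4 := (map_eq_zero_iff ψG hG.1).1 h2
    ext (i | i)
    · exact congrFun h3 i
    · exact congrFun h4 i
  have hrange : LinearMap.range (sumMap ψF ψG) = LinearMap.range ψ := by
    rw [hψ.2.1, Finset.coe_union, Set.image_union, Submodule.span_union, ← hF.2.1, ← hG.2.1]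
    apply le_antisymm
    · rintro _ ⟨z, rfl⟩
      exact Submodule.add_mem_sup ⟨_, rfl⟩ ⟨_, rfl⟩
    · rw [sup_le_iff]
      constructor
      · rintro _ ⟨y, rfl⟩
        refine ⟨Sum.elim y 0, ?_⟩
        change ψF y + ψG 0 = _
        simp
      · rintro _ ⟨y, rfl⟩
        refine ⟨Sum.elim 0 y, ?_⟩
        change ψF 0 + ψG y = _
        simp
  have hints : ∀ j, IsIntPt (sumMap ψF ψG (Pi.single j 1)) := by
    rintro (j | j)
    · have : sumMap ψF ψG (Pi.single (Sum.inl j) 1) = ψF (Pi.single j 1) := by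
        change ψF ((Pi.single (Sum.inl j) 1 : Fin a ⊕ Fin b → ℝ) ∘ Sum.inl) +
          ψG ((Pi.single (Sum.inl j) 1 : Fin a ⊕ Fin b → ℝ) ∘ Sum.inr) = _
        have e1 : ((Pi.single (Sum.inl j) 1 : Fin a ⊕ Fin b → ℝ) ∘ Sum.inl : Fin a → ℝ) = Pi.single j 1 := by
          ext i; simp [Pi.single_apply]
        have e2 : ((Pi.single (Sum.inl j) 1 : Fin a ⊕ Fin b → ℝ) ∘ Sum.inr : Fin b → ℝ) = 0 := by
          ext i; simp [Pi.single_apply]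
        rw [e1, e2]; simp
      rw [this, hF.2.2]; exact isInt_single j
    · have : sumMap ψF ψG (Pi.single (Sum.inr j) 1) = ψG (Pi.single j 1) := by
        change ψF ((Pi.single (Sum.inr j) 1 : Fin a ⊕ Fin b → ℝ) ∘ Sum.inl) +
          ψG ((Pi.single (Sum.inr j) 1 : Fin a ⊕ Fin b → ℝ) ∘ Sum.inr) = _
        have e1 : ((Pi.single (Sum.inr j) 1 : Fin a ⊕ Fin b → ℝ) ∘ Sum.inr : Fin b → ℝ) = Pi.single j 1 := by
          ext i; simp [Pi.single_apply]
        have e2 : ((Pi.single (Sum.inr j) 1 : Fin a ⊕ Fin b → ℝ) ∘ Sum.inl : Fin a → ℝ) = 0 := by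
          ext i; simp [Pi.single_apply]
        rw [e1, e2]; simp
      rw [this, hG.2.2]; exact isInt_single j
  constructor
  · have h1 := LinearMap.finrank_range_of_inj hinj
    have h2 := LinearMap.finrank_range_of_inj hψ.1
    rw [hrange, h2] at h1
    simpa using h1.symm
  · obtain ⟨m, hm⟩ := det_lemma ψ (sumMap ψF ψG) hψ.1 (fun y => (hψ.2.2 y).1) hinj hints hrange
    refine ⟨m, ?_⟩
    unfold cvol
    rw [hm]
    congr 1
    have mF : Measurable fun y => (wcone w F).indicator (gexp h) (ψF y) :=
      ((measurable_gexp h).indicator (measurableSet_wcone w F)).comp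
        ψF.continuous_of_finiteDimensional.measurable
    have mG : Measurable fun y => (wcone w G).indicator (gexp h) (ψG y) :=
      ((measurable_gexp h).indicator (measurableSet_wcone w G)).comp
        ψG.continuous_of_finiteDimensional.measurable
    rw [← lintegral_prod_mul mF.aemeasurable mG.aemeasurable]
    have hmp := volume_measurePreserving_sumPiEquivProdPi (fun _ : Fin a ⊕ Fin b => ℝ)
    have := hmp.lintegral_comp_emb (MeasurableEquiv.measurableEmbedding _) (fun z =>
      (wcone w F).indicator (gexp h) (ψF z.1) * (wcone w G).indicator (gexp h) (ψG z.2))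
    refine Eq.trans ?_ this
    refine lintegral_congr fun z => ?_
    change (wcone w (F ∪ G)).indicator (gexp h) (ψF (z ∘ Sum.inl) + ψG (z ∘ Sum.inr)) =
      (wcone w F).indicator (gexp h) (ψF (z ∘ Sum.inl)) *
      (wcone w G).indicator (gexp h) (ψG (z ∘ Sum.inr))
    have := wcone_add w F G hd _ _ (hsF (z ∘ Sum.inl)) (hsG (z ∘ Sum.inr))
    by_cases h1 : ψF (z ∘ Sum.inl) ∈ wcone w F
    · by_cases h2 : ψG (z ∘ Sum.inr) ∈ wcone w G
      · rw [Set.indicator_of_mem h1, Set.indicator_of_mem h2, Set.indicator_of_mem (this.2 ⟨h1, h2⟩)]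
        unfold gexp
        rw [← ENNReal.ofReal_mul (Real.exp_pos _).le, ← Real.exp_add, map_add]
        congr 2; ring
      · rw [Set.indicator_of_notMem h2, Set.indicator_of_notMem (fun h => h2 (this.1 h).2), mul_zero]
    · rw [Set.indicator_of_notMem h1, Set.indicator_of_notMem (fun h => h1 (this.1 h).1), zero_mul]

def IsCF {ι E : Type*} [AddCommGroup E] [Module ℝ E] (w : ι → E) (A F : Finset ι) : Prop :=
  ∃ c : E →ₗ[ℝ] ℝ, (∀ i ∈ A, 0 ≤ c (w i)) ∧ ∀ i, i ∈ F ↔ (i ∈ A ∧ c (w i) = 0)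

lemma eq_zero_on_span {E : Type*} [AddCommGroup E] [Module ℝ E] (s : Set E) (c : E →ₗ[ℝ] ℝ)
    (h : ∀ x ∈ s, c x = 0) (z : E) (hz : z ∈ Submodule.span ℝ s) : c z = 0 := by
  have : Submodule.span ℝ s ≤ LinearMap.ker c := Submodule.span_le.2 h
  exact this hz

lemma exists_generic {ι E : Type*} [Fintype ι] [AddCommGroup E] [Module ℝ E] [FiniteDimensional ℝ E]
    (w : ι → E) :
    ∃ α : E →ₗ[ℝ] ℝ, ∀ F G : Finset ι, (∀ z ∈ Submodule.span ℝ (w '' F),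
      z ∈ Submodule.span ℝ (w '' G) → α z = 0) →
      Disjoint (Submodule.span ℝ (w '' F)) (Submodule.span ℝ (w '' G)) := by
  classical
  let J := {p : Finset ι × Finset ι // ¬ Disjoint (Submodule.span ℝ (w '' p.1))
    (Submodule.span ℝ (w '' p.2))}
  have : ∀ p : J, ∃ z, z ∈ Submodule.span ℝ (w '' p.1.1) ∧ z ∈ Submodule.span ℝ (w '' p.1.2) ∧
      z ≠ 0 := by
    rintro ⟨p, hp⟩
    rw [Submodule.disjoint_def] at hp
    push Not at hp
    obtain ⟨z, h1, h2, h3⟩ := hp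
    exact ⟨z, h1, h2, h3⟩
  choose z hz1 hz2 hz3 using this
  obtain ⟨α, hα⟩ := Module.exists_dual_forall_apply_ne_zero (K := ℝ) z hz3
  refine ⟨α, fun F G h => ?_⟩
  by_contra hd
  exact hα ⟨(F, G), hd⟩ (h _ (hz1 ⟨(F, G), hd⟩) (hz2 ⟨(F, G), hd⟩))

theorem core {ι : Type*} [Fintype ι] {N d : ℕ} (h : (Fin N → ℝ) →ₗ[ℝ] ℝ)
    (w : ι → Fin N → ℝ) (hw : ∀ i, IsIntPt (w i)) (hh : ∀ i, h (w i) = 1) (A B S : Finset ι)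
    (hAB : Disjoint A B) (hS : ∀ i, i ∈ S ↔ i ∈ A ∨ i ∈ B) (e : ℕ)
    (H : ∀ F G : Finset ι, F ⊆ A → G ⊆ B → IsCF w A F → IsCF w B G →
      ∀ (a b : ℕ) (ψF : (Fin a → ℝ) →ₗ[ℝ] (Fin N → ℝ)) (ψG : (Fin b → ℝ) →ₗ[ℝ] (Fin N → ℝ)),
      LChart (Submodule.span ℝ (w '' F)) ψF → LChart (Submodule.span ℝ (w '' G)) ψG →
      a + b = d → ∃ m : ℕ, cvol h ψF (wcone w F) * cvol h ψG (wcone w G) = e * m)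
    (ψ : (Fin d → ℝ) →ₗ[ℝ] (Fin N → ℝ)) (hψ : LChart (Submodule.span ℝ (w '' S)) ψ) :
    ∃ m : ℕ, cvol h ψ (wcone w S) = e * m := by
  classical
  obtain ⟨ρ, hρ⟩ := LinearMap.exists_leftInverse_of_injective ψ (LinearMap.ker_eq_bot.2 hψ.1)
  have hρ' : ∀ y, ρ (ψ y) = y := fun y => LinearMap.congr_fun hρ y
  have hψw : ∀ i ∈ S, ψ (ρ (w i)) = w i := by
    intro i hi
    have : w i ∈ LinearMap.range ψ := by
      rw [hψ.2.1]; exact Submodule.subset_span ⟨i, hi, rfl⟩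
    obtain ⟨y, hy⟩ := this
    rw [← hy, hρ']
  let w' : ι → Fin d → ℝ := fun i => ρ (w i)
  have hcone : ∀ T ⊆ S, ∀ y, ψ y ∈ wcone w T ↔ y ∈ wcone w' T := by
    intro T hT y
    constructor
    · rintro ⟨t, t0, t1, t2⟩
      refine ⟨t, t0, t1, ?_⟩
      have := congrArg ρ t2
      rw [hρ'] at this
      simpa [w'] using this
    · rintro ⟨t, t0, t1, t2⟩
      refine ⟨t, t0, t1, ?_⟩
      rw [← t2, map_sum]
      refine Finset.sum_congr rfl fun i _ => ?_
      by_cases hi : i ∈ T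
      · rw [map_smul, hψw i (hT hi)]
      · simp [t1 i hi]
  have hcv : ∀ T ⊆ S, cvol h ψ (wcone w T) =
      ∫⁻ y, (wcone w' T).indicator (gexp (h ∘ₗ ψ)) y := by
    intro T hT
    refine lintegral_congr fun y => ?_
    by_cases hy : y ∈ wcone w' T
    · rw [Set.indicator_of_mem hy, Set.indicator_of_mem ((hcone T hT y).2 hy)]
      rfl
    · rw [Set.indicator_of_notMem hy, Set.indicator_of_notMem (fun h => hy ((hcone T hT y).1 h))]
  obtain ⟨α, hα⟩ := exists_generic w
  rw [hcv S (Finset.Subset.refl _), lintegral_subdivision volume w'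
    (fun i => if i ∈ A then α (w i) else 0) S (h ∘ₗ ψ)
    (fun i hi => by simp [w', hψw i hi, hh i]) _ (measurable_gexp _)]
  have hterm : ∀ T ∈ S.powerset.filter (fun T => IsCell w'
      (fun i => if i ∈ A then α (w i) else 0) S T),
      ∃ m : ℕ, ∫⁻ y, (wcone w' T).indicator (gexp (h ∘ₗ ψ)) y = e * m := by
    intro T hT
    rw [Finset.mem_filter, Finset.mem_powerset] at hT
    obtain ⟨hTS, hspan, l, l1, l2⟩ := hT
    beta_reduce at l1 l2
    rw [← hcv T hTS]
    let F := T.filter (· ∈ A)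
    let G := T.filter (· ∈ B)
    have hFG : F ∪ G = T := by
      ext i
      simp only [F, G, Finset.mem_union, Finset.mem_filter]
      constructor
      · tauto
      · intro hi
        have := (hS i).1 (hTS hi)
        tauto
    have hnB : ∀ i ∈ B, i ∉ A := fun i hi hA => Finset.disjoint_left.1 hAB hA hi
    have hF : IsCF w A F := by
      refine ⟨α - l ∘ₗ ρ, fun i hi => ?_, fun i => ?_⟩
      · have := l1 i ((hS i).2 (Or.inl hi))
        rw [if_pos hi] at this
        simpa [w'] using this
      · simp only [F, Finset.mem_filter, l2 i, LinearMap.sub_apply, sub_eq_zero,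
          LinearMap.comp_apply, w']
        constructor
        · rintro ⟨⟨h1, h2⟩, h3⟩
          rw [if_pos h3] at h2
          exact ⟨h3, h2.symm⟩
        · rintro ⟨h1, h2⟩
          rw [if_pos h1]
          exact ⟨⟨(hS i).2 (Or.inl h1), h2.symm⟩, h1⟩
    have hG : IsCF w B G := by
      refine ⟨- (l ∘ₗ ρ), fun i hi => ?_, fun i => ?_⟩
      · have := l1 i ((hS i).2 (Or.inr hi))
        rw [if_neg (hnB i hi)] at this
        simpa [w'] using this
      · simp only [G, Finset.mem_filter, l2 i, LinearMap.neg_apply, neg_eq_zero,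
          LinearMap.comp_apply, w']
        constructor
        · rintro ⟨⟨h1, h2⟩, h3⟩
          rw [if_neg (hnB i h3)] at h2
          exact ⟨h3, h2⟩
        · rintro ⟨h1, h2⟩
          rw [if_neg (hnB i h1)]
          exact ⟨⟨(hS i).2 (Or.inr h1), h2⟩, h1⟩
    have hdis : Disjoint (Submodule.span ℝ (w '' F)) (Submodule.span ℝ (w '' G)) := by
      apply hα
      intro z hz1 hz2
      have e1 : (α - l ∘ₗ ρ) z = 0 := by
        refine eq_zero_on_span _ _ ?_ z hz1
        rintro _ ⟨i, hi, rfl⟩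
        have hi' := Finset.mem_filter.1 hi
        have := ((l2 i).1 hi'.1).2
        rw [if_pos hi'.2] at this
        simp only [LinearMap.sub_apply, LinearMap.comp_apply, ← this, w', sub_self]
      have e2 : (l ∘ₗ ρ) z = 0 := by
        refine eq_zero_on_span _ _ ?_ z hz2
        rintro _ ⟨i, hi, rfl⟩
        have hi' := Finset.mem_filter.1 hi
        have := ((l2 i).1 hi'.1).2
        rw [if_neg (hnB i hi'.2)] at this
        exact this
      rw [LinearMap.sub_apply, e2, sub_zero] at e1
      exact e1
    have hspT : Submodule.span ℝ (w '' T) = LinearMap.range ψ := by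
      rw [LinearMap.range_eq_map, ← hspan, Submodule.map_span, Set.image_image]
      congr 1
      refine Set.image_congr fun i hi => (hψw i (hTS hi)).symm
    obtain ⟨ψF, hψF⟩ := exists_LChart (Submodule.span ℝ (w '' F)) (w '' F)
      (by rintro _ ⟨i, -, rfl⟩; exact hw i) rfl
    obtain ⟨ψG, hψG⟩ := exists_LChart (Submodule.span ℝ (w '' G)) (w '' G)
      (by rintro _ ⟨i, -, rfl⟩; exact hw i) rfl
    obtain ⟨hab, m, hm⟩ := cvol_join h w F G hdis ψ
      (by rw [hFG]; exact ⟨hψ.1, hspT.symm, hψ.2.2⟩) ψF hψF ψG hψG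
    obtain ⟨m', hm'⟩ := H F G (fun i hi => (Finset.mem_filter.1 hi).2)
      (fun i hi => (Finset.mem_filter.1 hi).2) hF hG _ _ ψF ψG hψF hψG hab
    rw [hFG, hm'] at hm
    refine ⟨m * m', ?_⟩
    rw [hm]; push_cast; ring
  choose! m hm using hterm
  refine ⟨∑ T ∈ S.powerset.filter (fun T => IsCell w'
      (fun i => if i ∈ A then α (w i) else 0) S T), m T, ?_⟩
  rw [Finset.sum_congr rfl hm, Nat.cast_sum, Finset.mul_sum]

/-- transfer between charts -/
lemma chart_transfer {ι : Type*} [Fintype ι] {N d d' : ℕ} (h : (Fin N → ℝ) →ₗ[ℝ] ℝ)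
    (w : ι → Fin N → ℝ) (S : Finset ι) (W : Submodule ℝ (Fin N → ℝ))
    (ψ : (Fin d → ℝ) →ₗ[ℝ] (Fin N → ℝ)) (hψ : LChart W ψ)
    (ψ' : (Fin d' → ℝ) →ₗ[ℝ] (Fin N → ℝ)) (hψ' : LChart W ψ') :
    ∃ m : ℕ, cvol h ψ (wcone w S) = m * cvol h ψ' (wcone w S) := by
  obtain ⟨m, hm⟩ := det_lemma ψ ψ' hψ.1 (fun y => (hψ.2.2 y).1) hψ'.1
    (fun j => (hψ'.2.2 _).2 (isInt_single j)) (hψ'.2.1.trans hψ.2.1.symm)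
  exact ⟨m, hm _⟩

lemma chart_dim {N d d' : ℕ} (W : Submodule ℝ (Fin N → ℝ))
    (ψ : (Fin d → ℝ) →ₗ[ℝ] (Fin N → ℝ)) (hψ : LChart W ψ)
    (ψ' : (Fin d' → ℝ) →ₗ[ℝ] (Fin N → ℝ)) (hψ' : LChart W ψ') : d = d' := by
  have h1 := LinearMap.finrank_range_of_inj hψ.1
  have h2 := LinearMap.finrank_range_of_inj hψ'.1
  rw [hψ.2.1] at h1
  rw [hψ'.2.1] at h2
  simpa [h1] using h2

theorem integrality {ι : Type*} [Fintype ι] {N : ℕ} (h : (Fin N → ℝ) →ₗ[ℝ] ℝ)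
    (w : ι → Fin N → ℝ) (hw : ∀ i, IsIntPt (w i)) (hh : ∀ i, h (w i) = 1)
    (hsing : ∀ (i : ι) (d : ℕ) (ψ : (Fin d → ℝ) →ₗ[ℝ] (Fin N → ℝ)),
      LChart (Submodule.span ℝ (w '' ({i} : Finset ι))) ψ → ∃ m : ℕ, cvol h ψ (wcone w {i}) = m)
    (S : Finset ι) :
    ∀ (d : ℕ) (ψ : (Fin d → ℝ) →ₗ[ℝ] (Fin N → ℝ)), LChart (Submodule.span ℝ (w '' S)) ψ →
      ∃ m : ℕ, cvol h ψ (wcone w S) = m := by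
  classical
  induction S using Finset.strongInduction with
  | H S ih =>
    intro d ψ hψ
    rcases S.eq_empty_or_nonempty with rfl | ⟨b, hb⟩
    · have hd : d = 0 := by
        have h1 := LinearMap.finrank_range_of_inj hψ.1
        rw [hψ.2.1, Finset.coe_empty, Set.image_empty, Submodule.span_empty] at h1
        simpa using h1.symm
      subst hd
      refine ⟨1, ?_⟩
      unfold cvol
      have : ∀ y : Fin 0 → ℝ, (wcone w ∅).indicator (gexp h) (ψ y) = 1 := by
        intro y
        have hy : ψ y = 0 := by rw [Subsingleton.elim y 0, map_zero]
        have h0 : (0 : Fin N → ℝ) ∈ wcone w ∅ := ⟨0, by simp⟩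
        rw [hy, Set.indicator_of_mem h0]
        simp [gexp]
      simp only [this]
      simp [volume_pi, Measure.pi_of_empty]
    · by_cases hS : S = {b}
      · subst hS; exact hsing b d ψ hψ
      · have hsub : {b} ⊂ S := by
          refine Finset.ssubset_iff_subset_ne.2 ⟨by simpa using hb, Ne.symm hS⟩
        obtain ⟨m, hm⟩ := core h w hw hh (S.erase b) {b} S (by simp)
          (fun i => by
            by_cases hi : i = b
            · subst hi; simp [hb]
            · simp [hi]) 1 (by
            intro F G hF hG _ _ a c ψF ψG hψF hψG _
            obtain ⟨m1, hm1⟩ := ih F (lt_of_le_of_lt hF (Finset.erase_ssubset hb)) a ψF hψF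
            obtain ⟨m2, hm2⟩ := ih G (lt_of_le_of_lt hG hsub) c ψG hψG
            exact ⟨m1 * m2, by rw [hm1, hm2]; simp⟩) ψ hψ
        exact ⟨m, by simpa using hm⟩

def hvec {n : ℕ} (x : Fin n → ℝ) : Fin (n+1) → ℝ := Fin.cons 1 x

def hht (n : ℕ) : (Fin (n+1) → ℝ) →ₗ[ℝ] ℝ := LinearMap.proj 0

lemma hht_hvec {n : ℕ} (x : Fin n → ℝ) : hht n (hvec x) = 1 := by simp [hht, hvec]

lemma isInt_cons {n : ℕ} (s : ℝ) (x : Fin n → ℝ) :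
    IsIntPt (Fin.cons s x : Fin (n+1) → ℝ) ↔ (∃ z : ℤ, s = z) ∧ IsIntPt x := by
  unfold IsIntPt
  rw [Fin.forall_fin_succ]
  simp

lemma isInt_hvec {n : ℕ} (x : Fin n → ℝ) (hx : IsIntPt x) : IsIntPt (hvec x) :=
  (isInt_cons _ _).2 ⟨⟨1, by simp⟩, hx⟩

lemma IsIntPt.add' {n : ℕ} {x y : Fin n → ℝ} (hx : IsIntPt x) (hy : IsIntPt y) :
    IsIntPt (x + y) := by
  intro i
  obtain ⟨a, ha⟩ := hx i
  obtain ⟨b, hb⟩ := hy i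
  exact ⟨a + b, by simp [ha, hb]⟩

lemma IsIntPt.sub' {n : ℕ} {x y : Fin n → ℝ} (hx : IsIntPt x) (hy : IsIntPt y) :
    IsIntPt (x - y) := by
  intro i
  obtain ⟨a, ha⟩ := hx i
  obtain ⟨b, hb⟩ := hy i
  exact ⟨a - b, by simp [ha, hb]⟩

lemma IsIntPt.zsmul' {n : ℕ} {x : Fin n → ℝ} (hx : IsIntPt x) (z : ℤ) :
    IsIntPt ((z : ℝ) • x) := by
  intro i
  obtain ⟨a, ha⟩ := hx i
  exact ⟨z * a, by simp [ha]⟩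

/-- homogenized chart -/
def hmap {n r : ℕ} (x0 : Fin n → ℝ) (θ : (Fin r → ℝ) →ₗ[ℝ] (Fin n → ℝ)) :
    (Fin (r+1) → ℝ) →ₗ[ℝ] (Fin (n+1) → ℝ) where
  toFun y := Fin.cons (y 0) (y 0 • x0 + θ (Fin.tail y))
  map_add' y z := by
    ext i
    refine Fin.cases ?_ (fun i => ?_) i
    · simp
    · have : Fin.tail (y + z) = Fin.tail y + Fin.tail z := rfl
      simp [this]; ring
  map_smul' c y := by
    ext i
    refine Fin.cases ?_ (fun i => ?_) i
    · simp
    · have : Fin.tail (c • y) = c • Fin.tail y := rfl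
      simp [this]; ring

lemma hmap_cons {n r : ℕ} (x0 : Fin n → ℝ) (θ : (Fin r → ℝ) →ₗ[ℝ] (Fin n → ℝ)) (s : ℝ)
    (z : Fin r → ℝ) : hmap x0 θ (Fin.cons s z) = Fin.cons s (s • x0 + θ z) := by
  simp [hmap]

lemma hmap_LChart {ι : Type*} {n r : ℕ} (u : ι → Fin n → ℝ) (U : Finset ι) (hU : U.Nonempty)
    (x0 : Fin n → ℝ) (θ : (Fin r → ℝ) →ₗ[ℝ] (Fin n → ℝ))
    (hx0 : x0 ∈ affineSpan ℝ (u '' U)) (hx0i : IsIntPt x0)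
    (hθ : LChart (affineSpan ℝ (u '' U)).direction θ) :
    LChart (Submodule.span ℝ ((fun i => hvec (u i)) '' U)) (hmap x0 θ) := by
  obtain ⟨i0, hi0⟩ := hU
  have key : ∀ d ∈ (affineSpan ℝ (u '' U)).direction,
      (Fin.cons 0 d : Fin (n+1) → ℝ) ∈ Submodule.span ℝ ((fun i => hvec (u i)) '' U) := by
    let L : (Fin n → ℝ) →ₗ[ℝ] (Fin (n+1) → ℝ) :=
      { toFun := fun d => Fin.cons 0 d
        map_add' := fun a b => by
          ext i; refine Fin.cases ?_ (fun i => ?_) i <;> simp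
        map_smul' := fun a b => by
          ext i; refine Fin.cases ?_ (fun i => ?_) i <;> simp }
    have : (affineSpan ℝ (u '' U)).direction ≤
        (Submodule.span ℝ ((fun i => hvec (u i)) '' U)).comap L := by
      rw [direction_affineSpan, vectorSpan_def, Submodule.span_le]
      rintro _ ⟨_, ⟨i, hi, rfl⟩, _, ⟨j, hj, rfl⟩, rfl⟩
      have : L (u i - u j) = hvec (u i) - hvec (u j) := by
        ext k; refine Fin.cases ?_ (fun k => ?_) k <;> simp [L, hvec]
      change L (u i - u j) ∈ Submodule.span ℝ ((fun i => hvec (u i)) '' (U : Set ι))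
      rw [this]
      exact Submodule.sub_mem _ (Submodule.subset_span ⟨i, hi, rfl⟩)
        (Submodule.subset_span ⟨j, hj, rfl⟩)
    exact fun d hd => this hd
  have hmemA : ∀ i ∈ U, u i ∈ affineSpan ℝ (u '' U) := fun i hi =>
    subset_affineSpan _ _ ⟨i, hi, rfl⟩
  refine ⟨?_, ?_, ?_⟩
  · rw [← LinearMap.ker_eq_bot, LinearMap.ker_eq_bot']
    intro y hy
    have h0 : y 0 = 0 := by simpa [hmap] using congrFun hy 0
    have h1 : θ (Fin.tail y) = 0 := by
      ext k
      simpa [hmap, h0] using congrFun hy k.succ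
    have h2 : Fin.tail y = 0 := hθ.1 (by simpa using h1)
    ext k
    refine Fin.cases h0 (fun k => ?_) k
    exact congrFun h2 k
  · apply le_antisymm
    · rintro _ ⟨y, rfl⟩
      have h1 : x0 - u i0 ∈ (affineSpan ℝ (u '' U)).direction :=
        AffineSubspace.vsub_mem_direction hx0 (hmemA i0 hi0)
      have h2 : θ (Fin.tail y) ∈ (affineSpan ℝ (u '' U)).direction := by
        rw [← hθ.2.1]; exact ⟨_, rfl⟩
      have : hmap x0 θ y = y 0 • hvec (u i0) + y 0 • (Fin.cons 0 (x0 - u i0) : Fin (n+1) → ℝ) +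
          (Fin.cons 0 (θ (Fin.tail y)) : Fin (n+1) → ℝ) := by
        ext k; refine Fin.cases ?_ (fun k => ?_) k
        · simp [hmap, hvec]
        · simp [hmap, hvec]; ring
      rw [this]
      exact Submodule.add_mem _ (Submodule.add_mem _ (Submodule.smul_mem _ _
        (Submodule.subset_span ⟨i0, hi0, rfl⟩)) (Submodule.smul_mem _ _ (key _ h1))) (key _ h2)
    · rw [Submodule.span_le]
      rintro _ ⟨i, hi, rfl⟩
      have h1 : u i - x0 ∈ (affineSpan ℝ (u '' U)).direction :=
        AffineSubspace.vsub_mem_direction (hmemA i hi) hx0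
      rw [← hθ.2.1] at h1
      obtain ⟨z, hz⟩ := h1
      refine ⟨Fin.cons 1 z, ?_⟩
      rw [hmap_cons, hz]
      simp [hvec]
  · intro y
    have hy : y = Fin.cons (y 0) (Fin.tail y) := (Fin.cons_self_tail y).symm
    rw [hy, hmap_cons, isInt_cons, isInt_cons, ← hθ.2.2]
    refine and_congr_right ?_
    rintro ⟨z, hz⟩
    rw [hz]
    constructor
    · intro h
      have := h.sub' (hx0i.zsmul' z)
      simpa using this
    · intro h
      exact (hx0i.zsmul' z).add' h

lemma chart_data {n r : ℕ} (X : Set (Fin n → ℝ)) (φ : (Fin n → ℝ) →ᵃ[ℝ] (Fin r → ℝ))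
    (hφ : IsLatticeChart X φ) : ∃ (x0 : Fin n → ℝ) (θ : (Fin r → ℝ) →ₗ[ℝ] (Fin n → ℝ)),
    x0 ∈ affineSpan ℝ X ∧ IsIntPt x0 ∧ LChart (affineSpan ℝ X).direction θ ∧
    ∀ y, φ (x0 + θ y) = y := by
  obtain ⟨⟨-, hinj, hsurj⟩, hint⟩ := hφ
  obtain ⟨x0, hx0, hx0'⟩ := hsurj (Set.mem_univ (0 : Fin r → ℝ))
  have hx0' : φ x0 = 0 := hx0'
  set D := (affineSpan ℝ X).direction
  have hlin : ∀ d, φ (x0 + d) = φ.linear d := by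
    intro d
    have := φ.map_vadd x0 d
    simp only [vadd_eq_add, hx0', add_zero] at this
    rw [add_comm, this]
  have hmem : ∀ d ∈ D, x0 + d ∈ affineSpan ℝ X := by
    intro d hd
    have := AffineSubspace.vadd_mem_of_mem_direction hd hx0
    rwa [vadd_eq_add, add_comm] at this
  have hbij : Function.Bijective (φ.linear.comp D.subtype) := by
    constructor
    · rintro ⟨a, ha⟩ ⟨b, hb⟩ hab
      have : x0 + a = x0 + b := hinj (hmem a ha) (hmem b hb) (by
        change φ _ = φ _
        rw [hlin, hlin]; exact hab)
      exact Subtype.ext (add_left_cancel this)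
    · intro y
      obtain ⟨x, hx, hxy⟩ := hsurj (Set.mem_univ y)
      refine ⟨⟨x - x0, AffineSubspace.vsub_mem_direction hx hx0⟩, ?_⟩
      change φ.linear (x - x0) = y
      rw [← hlin]; simpa using hxy
  let e := LinearEquiv.ofBijective _ hbij
  have he : ∀ y, φ.linear (e.symm y : Fin n → ℝ) = y := fun y => e.apply_symm_apply y
  refine ⟨x0, D.subtype.comp e.symm.toLinearMap, hx0, ?_, ⟨?_, ?_, ?_⟩, ?_⟩
  · rw [hint _ hx0, hx0']; exact fun i => ⟨0, by simp⟩
  · exact Subtype.val_injective.comp e.symm.injective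
  · ext d
    constructor
    · rintro ⟨y, rfl⟩; exact (e.symm y).2
    · intro hd; exact ⟨e ⟨d, hd⟩, by simp⟩
  · intro y
    have hx0i : IsIntPt x0 := by rw [hint _ hx0, hx0']; exact fun i => ⟨0, by simp⟩
    have h1 := hint _ (hmem _ (e.symm y).2)
    rw [hlin, he] at h1
    rw [← h1]
    constructor
    · intro h; exact hx0i.add' h
    · intro h
      have := h.sub' hx0i
      simpa using this
  · intro y
    rw [hlin]; exact he y

lemma exists_chart {ι : Type*} {n : ℕ} (u : ι → Fin n → ℝ) (hu : ∀ i, IsIntPt (u i))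
    (U : Finset ι) (hU : U.Nonempty) :
    ∃ φ : (Fin n → ℝ) →ᵃ[ℝ] (Fin (polyDim (convexHull ℝ (u '' U))) → ℝ),
      IsLatticeChart (convexHull ℝ (u '' U)) φ := by
  unfold polyDim IsLatticeChart
  rw [affineSpan_convexHull]
  obtain ⟨i0, hi0⟩ := hU
  have h0 : u i0 ∈ affineSpan ℝ (u '' U) := subset_affineSpan _ _ ⟨i0, hi0, rfl⟩
  obtain ⟨θ, hθ⟩ := exists_LChart (affineSpan ℝ (u '' U)).direction ((u '' U) -ᵥ (u '' U))
    (by rintro _ ⟨_, ⟨i, hi, rfl⟩, _, ⟨j, hj, rfl⟩, rfl⟩; exact (hu i).sub' (hu j))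
    (by rw [direction_affineSpan, vectorSpan_def])
  obtain ⟨ρ, hρ⟩ := LinearMap.exists_leftInverse_of_injective θ (LinearMap.ker_eq_bot.2 hθ.1)
  have hρ' : ∀ y, ρ (θ y) = y := fun y => LinearMap.congr_fun hρ y
  refine ⟨ρ.toAffineMap.comp ((AffineMap.id ℝ (Fin n → ℝ)) - AffineMap.const ℝ _ (u i0)), ?_⟩
  have hap : ∀ x, (ρ.toAffineMap.comp ((AffineMap.id ℝ (Fin n → ℝ)) -
      AffineMap.const ℝ _ (u i0))) x = ρ (x - u i0) := fun x => rfl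
  have hex : ∀ x ∈ affineSpan ℝ (u '' U), ∃ y, x = u i0 + θ y := by
    intro x hx
    have : x - u i0 ∈ LinearMap.range θ := by
      rw [hθ.2.1]; exact AffineSubspace.vsub_mem_direction hx h0
    obtain ⟨y, hy⟩ := this
    exact ⟨y, by rw [hy]; simp⟩
  refine ⟨⟨fun _ _ => Set.mem_univ _, ?_, ?_⟩, ?_⟩
  · intro x hx y hy hxy
    obtain ⟨a, rfl⟩ := hex x hx
    obtain ⟨b, rfl⟩ := hex y hy
    simp only [hap, add_sub_cancel_left, hρ'] at hxy
    rw [hxy]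
  · intro y _
    refine ⟨u i0 + θ y, ?_, ?_⟩
    · have : θ y ∈ (affineSpan ℝ (u '' U)).direction :=
        hθ.2.1.le ⟨_, rfl⟩
      have := AffineSubspace.vadd_mem_of_mem_direction this h0
      rwa [vadd_eq_add, add_comm] at this
    · simp only [hap, add_sub_cancel_left, hρ']
  · intro x hx
    obtain ⟨a, rfl⟩ := hex x hx
    simp only [hap, add_sub_cancel_left, hρ']
    rw [← hθ.2.2]
    constructor
    · intro h
      have := h.sub' (hu i0)
      simpa using this
    · intro h; exact (hu i0).add' h

lemma cone_slice {ι : Type*} [Fintype ι] {n : ℕ} (u : ι → Fin n → ℝ) (U : Finset ι) (s : ℝ)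
    (hs : 0 < s) (x : Fin n → ℝ) :
    (Fin.cons s x : Fin (n+1) → ℝ) ∈ wcone (fun i => hvec (u i)) U ↔
      s⁻¹ • x ∈ convexHull ℝ (u '' U) := by
  classical
  constructor
  · rintro ⟨t, h0, h1, h2⟩
    have hs' : ∑ i, t i = s := by
      have := congrFun h2 0
      simpa [hvec, Finset.sum_apply] using this
    have hx : ∑ i, t i • u i = x := by
      ext k
      have := congrFun h2 k.succ
      simpa [hvec, Finset.sum_apply] using this
    have hz : ∀ i ∈ Finset.univ, i ∉ U → s⁻¹ * t i = 0 := fun i _ hi => by simp [h1 i hi]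
    have : s⁻¹ • x = ∑ i ∈ U, (s⁻¹ * t i) • u i := by
      rw [← hx, Finset.smul_sum, Finset.sum_subset (Finset.subset_univ U)
        (fun i _ hi => by rw [h1 i hi]; simp)]
      simp [smul_smul]
    rw [this]
    refine (convex_convexHull ℝ _).sum_mem (fun i _ => mul_nonneg (inv_nonneg.2 hs.le) (h0 i)) ?_
      (fun i hi => subset_convexHull _ _ ⟨i, hi, rfl⟩)
    rw [Finset.sum_subset (Finset.subset_univ U) hz, ← Finset.mul_sum, hs']
    field_simp
  · intro h
    have hsub : convexHull ℝ (u '' U) ⊆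
        {x | (hvec x : Fin (n+1) → ℝ) ∈ wcone (fun i => hvec (u i)) U} := by
      apply convexHull_min
      · rintro _ ⟨i, hi, rfl⟩
        refine ⟨fun j => if j = i then 1 else 0, ?_, ?_, ?_⟩
        · intro j; dsimp only; split_ifs <;> norm_num
        · intro j hj
          have : j ≠ i := by rintro rfl; exact hj hi
          simp [this]
        · simp
      · rintro x ⟨t, h0, h1, h2⟩ y ⟨t', h0', h1', h2'⟩ a b ha hb hab
        refine ⟨fun i => a * t i + b * t' i, ?_, ?_, ?_⟩
        · intro i; have := h0 i; have := h0' i; positivity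
        · intro i hi; simp [h1 i hi, h1' i hi]
        · simp only [add_smul, mul_smul, Finset.sum_add_distrib, ← Finset.smul_sum, h2, h2']
          ext k; refine Fin.cases ?_ (fun k => ?_) k
          · simp [hvec, hab]
          · simp [hvec]
    obtain ⟨t, h0, h1, h2⟩ := hsub h
    refine ⟨fun i => s * t i, fun i => mul_nonneg hs.le (h0 i), fun i hi => by simp [h1 i hi], ?_⟩
    simp only [mul_smul, ← Finset.smul_sum, h2]
    ext k; refine Fin.cases ?_ (fun k => ?_) k
    · simp [hvec]
    · simp [hvec, hs.ne']

lemma cone_neg {ι : Type*} [Fintype ι] {n : ℕ} (u : ι → Fin n → ℝ) (U : Finset ι) (s : ℝ)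
    (hs : s < 0) (x : Fin n → ℝ) :
    (Fin.cons s x : Fin (n+1) → ℝ) ∉ wcone (fun i => hvec (u i)) U := by
  rintro ⟨t, h0, h1, h2⟩
  have hs' : ∑ i, t i = s := by
    have := congrFun h2 0
    simpa [hvec, Finset.sum_apply] using this
  have := Finset.sum_nonneg (s := Finset.univ) (fun i _ => h0 i)
  linarith

lemma gamma_lint (r : ℕ) : ∫⁻ s in Set.Ioi (0:ℝ), ENNReal.ofReal (Real.exp (-s) * s ^ r) =
    (r.factorial : ENNReal) := by
  have h1 := Real.GammaIntegral_convergent (s := (r:ℝ) + 1) (by positivity)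
  have h2 := Real.Gamma_eq_integral (s := (r:ℝ) + 1) (by positivity)
  rw [Real.Gamma_nat_eq_factorial] at h2
  have hpow : ∀ x ∈ Set.Ioi (0:ℝ), Real.exp (-x) * x ^ ((r:ℝ)+1-1) = Real.exp (-x) * x ^ r := by
    intro x hx
    simp
  rw [← ENNReal.ofReal_natCast, h2, ofReal_integral_eq_lintegral_ofReal h1]
  · refine setLIntegral_congr_fun measurableSet_Ioi fun x hx => ?_
    simp
  · filter_upwards [ae_restrict_mem measurableSet_Ioi] with x hx
    have hx : 0 < x := hx
    positivity

lemma cvol_hmap {ι : Type*} [Fintype ι] {n r : ℕ} (u : ι → Fin n → ℝ) (U : Finset ι)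
    (x0 : Fin n → ℝ) (θ : (Fin r → ℝ) →ₗ[ℝ] (Fin n → ℝ)) :
    cvol (hht n) (hmap x0 θ) (wcone (fun i => hvec (u i)) U) =
      r.factorial * volume {y | x0 + θ y ∈ convexHull ℝ (u '' U)} := by
  classical
  set Y := {y | x0 + θ y ∈ convexHull ℝ (u '' U)} with hY
  set C := wcone (fun i => hvec (u i)) U with hC
  have hYm : MeasurableSet Y := by
    have h1 : MeasurableSet (convexHull ℝ (u '' (U : Set ι))) :=
      ((U.finite_toSet.image u).isCompact_convexHull ℝ).isClosed.measurableSet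
    have h2 : Measurable fun y => x0 + θ y :=
      (continuous_const.add (LinearMap.continuous_of_finiteDimensional θ)).measurable
    exact h2 h1
  have hmeas : Measurable fun y => C.indicator (gexp (hht n)) (hmap x0 θ y) :=
    ((measurable_gexp (hht n)).indicator (measurableSet_wcone _ _)).comp
      (LinearMap.continuous_of_finiteDimensional (hmap x0 θ)).measurable
  unfold cvol
  have hmp := (volume_preserving_piFinSuccAbove (fun _ : Fin (r+1) => ℝ) 0).symm
  rw [← hmp.lintegral_comp hmeas]
  rw [show (volume : Measure (ℝ × (Fin r → ℝ))) = volume.prod volume from rfl]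
  refine (lintegral_prod _ (hmeas.comp hmp.measurable).aemeasurable).trans ?_
  simp only [Function.comp]
  have hval : ∀ (s : ℝ) (z : Fin r → ℝ),
      (MeasurableEquiv.piFinSuccAbove (fun _ : Fin (r+1) => ℝ) 0).symm (s, z) =
      (Fin.cons s z : Fin (r+1) → ℝ) := by
    intro s z
    ext k
    simp [MeasurableEquiv.piFinSuccAbove, Fin.insertNthEquiv]
  simp only [hval, hmap_cons]
  have hpos : ∀ s : ℝ, 0 < s → ∫⁻ z, C.indicator (gexp (hht n)) (Fin.cons s (s • x0 + θ z)) =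
      ENNReal.ofReal (Real.exp (-s) * s ^ r) * volume Y := by
    intro s hs
    have h1 : ∀ z, C.indicator (gexp (hht n)) (Fin.cons s (s • x0 + θ z)) =
        (s • Y).indicator (fun _ => ENNReal.ofReal (Real.exp (-s))) z := by
      intro z
      have hiff : (Fin.cons s (s • x0 + θ z) : Fin (n+1) → ℝ) ∈ C ↔ z ∈ s • Y := by
        rw [hC, cone_slice u U s hs, Set.mem_smul_set_iff_inv_smul_mem₀ hs.ne']
        simp [hY, smul_add, hs.ne']
      by_cases hz : z ∈ s • Y
      · rw [Set.indicator_of_mem (hiff.2 hz), Set.indicator_of_mem hz]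
        simp [gexp, hht]
      · rw [Set.indicator_of_notMem (fun h => hz (hiff.1 h)), Set.indicator_of_notMem hz]
    simp only [h1]
    rw [lintegral_indicator (hYm.const_smul₀ s), setLIntegral_const, Measure.addHaar_smul]
    rw [← mul_assoc, ← ENNReal.ofReal_mul (Real.exp_pos _).le]
    simp [abs_of_pos hs]
  have hneg : ∀ s : ℝ, s < 0 → ∫⁻ z, C.indicator (gexp (hht n)) (Fin.cons s (s • x0 + θ z)) = 0 := by
    intro s hs
    simp [Set.indicator_of_notMem (cone_neg u U s hs _), hC]
  calc ∫⁻ s, ∫⁻ z, C.indicator (gexp (hht n)) (Fin.cons s (s • x0 + θ z))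
      = ∫⁻ s, (Set.Ioi (0:ℝ)).indicator
          (fun s => ENNReal.ofReal (Real.exp (-s) * s ^ r) * volume Y) s := by
        apply lintegral_congr_ae
        have : ∀ᵐ s : ℝ, s ≠ 0 := by
          simp [ae_iff]
        filter_upwards [this] with s hs
        rcases lt_or_gt_of_ne hs with h | h
        · rw [hneg s h, Set.indicator_of_notMem (by simp [h.le])]
        · rw [hpos s h, Set.indicator_of_mem (by simpa using h)]
    _ = _ := by
        rw [lintegral_indicator measurableSet_Ioi, lintegral_mul_const _ (by fun_prop),
          gamma_lint]


lemma link {ι : Type*} [Fintype ι] {n : ℕ} (u : ι → Fin n → ℝ) (hu : ∀ i, IsIntPt (u i))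
    (U : Finset ι) (hU : U.Nonempty) :
    ∃ ψ : (Fin (polyDim (convexHull ℝ (u '' U)) + 1) → ℝ) →ₗ[ℝ] (Fin (n+1) → ℝ),
      LChart (Submodule.span ℝ ((fun i => hvec (u i)) '' U)) ψ ∧
      0 ≤ normVol (convexHull ℝ (u '' U)) ∧
      cvol (hht n) ψ (wcone (fun i => hvec (u i)) U) =
        ENNReal.ofReal (normVol (convexHull ℝ (u '' U))) := by
  have hex := exists_chart u hu U hU
  set X := convexHull ℝ (u '' (U : Set ι)) with hX
  have hnv : normVol X = (Nat.factorial (polyDim X)) *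
      (volume ((fun x => hex.choose x) '' X)).toReal := by
    unfold normVol
    rw [dif_pos hex]
  have hφ := hex.choose_spec
  set φ := hex.choose
  obtain ⟨x0, θ, hx0, hx0i, hθ, hφθ⟩ := chart_data X φ hφ
  have haff : affineSpan ℝ X = affineSpan ℝ (u '' (U : Set ι)) := affineSpan_convexHull _
  have hc := cvol_hmap u U x0 θ
  have hYeq : {y | x0 + θ y ∈ convexHull ℝ (u '' (U : Set ι))} = (fun x => φ x) '' X := by
    ext y
    constructor
    · intro hy; exact ⟨_, hy, hφθ y⟩
    · rintro ⟨x, hx, rfl⟩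
      have hxa : x ∈ affineSpan ℝ X := subset_affineSpan _ _ hx
      have : x - x0 ∈ LinearMap.range θ := by
        rw [hθ.2.1]; exact AffineSubspace.vsub_mem_direction hxa hx0
      obtain ⟨y, hy⟩ := this
      have hxy : x = x0 + θ y := by rw [hy]; simp
      change x0 + θ (φ x) ∈ X
      rw [hxy, hφθ, ← hxy]; exact hx
  refine ⟨hmap x0 θ, hmap_LChart u U hU x0 θ (haff ▸ hx0) hx0i
    ⟨hθ.1, by rw [hθ.2.1, haff], hθ.2.2⟩, ?_, ?_⟩
  · rw [hnv]; positivity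
  · rw [hc, hYeq, hnv, ENNReal.ofReal_mul (by positivity), ENNReal.ofReal_natCast,
      ENNReal.ofReal_toReal]
    have hcomp : IsCompact X := (U.finite_toSet.image u).isCompact_convexHull ℝ
    exact (hcomp.image φ.continuous_of_finiteDimensional).measure_lt_top.ne

lemma even_of_link {ι : Type*} [Fintype ι] {n : ℕ} (u : ι → Fin n → ℝ) (hu : ∀ i, IsIntPt (u i))
    (U : Finset ι) (hU : U.Nonempty)
    (hE : EvenVol (convexHull ℝ (u '' U))) (d : ℕ) (ψ : (Fin d → ℝ) →ₗ[ℝ] (Fin (n+1) → ℝ))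
    (hψ : LChart (Submodule.span ℝ ((fun i => hvec (u i)) '' U)) ψ) :
    ∃ m : ℕ, cvol (hht n) ψ (wcone (fun i => hvec (u i)) U) = 2 * m := by
  obtain ⟨ψ', hψ', h0, h1⟩ := link u hu U hU
  obtain ⟨m, hm⟩ := chart_transfer (hht n) (fun i => hvec (u i)) U _ ψ hψ ψ' hψ'
  obtain ⟨z, hz⟩ := hE
  have hz0 : 0 ≤ z := by
    rw [hz] at h0
    have : (0:ℝ) ≤ z := by linarith
    exact_mod_cast this
  lift z to ℕ using hz0
  refine ⟨m * z, ?_⟩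
  have h2 : ENNReal.ofReal (normVol (convexHull ℝ (u '' (U : Set ι)))) = 2 * z := by
    rw [hz, ENNReal.ofReal_mul (by norm_num)]
    simp
  rw [hm, h1, h2]; push_cast; ring

lemma link_even {ι : Type*} [Fintype ι] {n : ℕ} (u : ι → Fin n → ℝ) (hu : ∀ i, IsIntPt (u i))
    (U : Finset ι) (hU : U.Nonempty)
    (hE : ∀ ψ : (Fin (polyDim (convexHull ℝ (u '' U)) + 1) → ℝ) →ₗ[ℝ] (Fin (n+1) → ℝ),
      LChart (Submodule.span ℝ ((fun i => hvec (u i)) '' U)) ψ →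
      ∃ m : ℕ, cvol (hht n) ψ (wcone (fun i => hvec (u i)) U) = 2 * m) :
    EvenVol (convexHull ℝ (u '' U)) := by
  obtain ⟨ψ', hψ', h0, h1⟩ := link u hu U hU
  obtain ⟨m, hm⟩ := hE ψ' hψ'
  refine ⟨m, ?_⟩
  rw [← ENNReal.toReal_ofReal h0, ← h1, hm]
  simp

lemma link_dim {ι : Type*} [Fintype ι] {n : ℕ} (u : ι → Fin n → ℝ) (hu : ∀ i, IsIntPt (u i))
    (U : Finset ι) (hU : U.Nonempty) (d : ℕ) (ψ : (Fin d → ℝ) →ₗ[ℝ] (Fin (n+1) → ℝ))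
    (hψ : LChart (Submodule.span ℝ ((fun i => hvec (u i)) '' U)) ψ) :
    d = polyDim (convexHull ℝ (u '' U)) + 1 := by
  obtain ⟨ψ', hψ', h0, h1⟩ := link u hu U hU
  exact chart_dim _ ψ hψ ψ' hψ'

lemma link_sing {ι : Type*} [Fintype ι] {n : ℕ} (u : ι → Fin n → ℝ) (hu : ∀ i, IsIntPt (u i))
    (i : ι) (d : ℕ) (ψ : (Fin d → ℝ) →ₗ[ℝ] (Fin (n+1) → ℝ))
    (hψ : LChart (Submodule.span ℝ ((fun i => hvec (u i)) '' ({i} : Finset ι))) ψ) :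
    ∃ m : ℕ, cvol (hht n) ψ (wcone (fun i => hvec (u i)) {i}) = m := by
  have hθ : LChart (affineSpan ℝ (u '' ({i} : Finset ι))).direction
      (0 : (Fin 0 → ℝ) →ₗ[ℝ] (Fin n → ℝ)) := by
    refine ⟨Function.injective_of_subsingleton _, ?_, ?_⟩
    · rw [direction_affineSpan]; simp
    · intro y
      refine ⟨fun _ j => j.elim0, fun _ j => ⟨0, by simp⟩⟩
  have hL := hmap_LChart u {i} (Finset.singleton_nonempty i) (u i) 0
    (subset_affineSpan _ _ ⟨i, by simp, rfl⟩) (hu i) hθ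
  obtain ⟨m, hm⟩ := chart_transfer (hht n) (fun i => hvec (u i)) {i} _ ψ hψ _ hL
  refine ⟨m, ?_⟩
  rw [hm, cvol_hmap]
  simp [volume_pi, Measure.pi_of_empty]


lemma dotR_add_smul {n : ℕ} (c x y : Fin n → ℝ) (a b : ℝ) :
    dotR c (a • x + b • y) = a * dotR c x + b * dotR c y := by
  unfold dotR
  rw [Finset.mul_sum, Finset.mul_sum, ← Finset.sum_add_distrib]
  refine Finset.sum_congr rfl fun i _ => ?_
  simp; ring

lemma dotR_comb_left {n : ℕ} (c c' x : Fin n → ℝ) (K : ℝ) :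
    dotR (K • c + c') x = K * dotR c x + dotR c' x := by
  unfold dotR
  rw [Finset.mul_sum, ← Finset.sum_add_distrib]
  refine Finset.sum_congr rfl fun i _ => ?_
  simp; ring

lemma dotR_sum {ι : Type*} {n : ℕ} (c : Fin n → ℝ) (s : Finset ι) (t : ι → ℝ)
    (u : ι → Fin n → ℝ) : dotR c (∑ i ∈ s, t i • u i) = ∑ i ∈ s, t i * dotR c (u i) := by
  classical
  induction s using Finset.induction_on with
  | empty => simp [dotR]
  | insert a s ha ih =>
    rw [Finset.sum_insert ha, Finset.sum_insert ha, ← ih]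
    have := dotR_add_smul c (u a) (∑ i ∈ s, t i • u i) (t a) 1
    simpa using this

lemma lin_hvec {n : ℕ} (c : (Fin (n+1) → ℝ) →ₗ[ℝ] ℝ) : ∃ (β : ℝ) (c1 : Fin n → ℝ),
    ∀ x, c (hvec x) = β + dotR c1 x := by
  classical
  refine ⟨c (Pi.single 0 1), fun j => c (Pi.single j.succ 1), fun x => ?_⟩
  rw [LinearMap.pi_apply_eq_sum_univ c (hvec x), Fin.sum_univ_succ]
  have h : ∀ j : Fin (n+1), (fun k => if j = k then (1:ℝ) else 0) = Pi.single j 1 := by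
    intro j; ext k; simp [Pi.single_apply, eq_comm]
  simp only [h]
  simp [hvec, dotR, mul_comm]

lemma argmin_hull {ι : Type*} [Fintype ι] {n : ℕ} (u : ι → Fin n → ℝ) (S T : Finset ι)
    (c : Fin n → ℝ) (μ : ℝ) (hμ : ∀ i ∈ S, μ ≤ dotR c (u i))
    (hT : ∀ i, i ∈ T ↔ i ∈ S ∧ dotR c (u i) = μ) (hTn : T.Nonempty) :
    argminSet c (convexHull ℝ (u '' S)) = convexHull ℝ (u '' T) := by
  classical
  have hTS : T ⊆ S := fun i hi => ((hT i).1 hi).1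
  have hge : ∀ y ∈ convexHull ℝ (u '' (S : Set ι)), μ ≤ dotR c y := by
    have : convexHull ℝ (u '' (S : Set ι)) ⊆ {y | μ ≤ dotR c y} := by
      apply convexHull_min
      · rintro _ ⟨i, hi, rfl⟩; exact hμ i hi
      · intro x hx y hy a b ha hb hab
        have hx : μ ≤ dotR c x := hx
        have hy : μ ≤ dotR c y := hy
        change μ ≤ dotR c _
        rw [dotR_add_smul]
        have : μ = a * μ + b * μ := by rw [← add_mul, hab, one_mul]
        nlinarith [mul_le_mul_of_nonneg_left hx ha, mul_le_mul_of_nonneg_left hy hb]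
    exact this
  have heq : ∀ y ∈ convexHull ℝ (u '' (T : Set ι)), dotR c y = μ := by
    have : convexHull ℝ (u '' (T : Set ι)) ⊆ {y | dotR c y = μ} := by
      apply convexHull_min
      · rintro _ ⟨i, hi, rfl⟩; exact ((hT i).1 hi).2
      · intro x hx y hy a b ha hb hab
        have hx : dotR c x = μ := hx
        have hy : dotR c y = μ := hy
        change dotR c _ = μ
        rw [dotR_add_smul, hx, hy, ← add_mul, hab, one_mul]
    exact this
  ext x
  constructor
  · rintro ⟨hx, hmin⟩
    obtain ⟨i0, hi0⟩ := hTn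
    have hxμ : dotR c x = μ := by
      refine le_antisymm ?_ (hge x hx)
      have := hmin (u i0) (subset_convexHull _ _ ⟨i0, hTS hi0, rfl⟩)
      rwa [((hT i0).1 hi0).2] at this
    have h1 := (cone_slice u S 1 one_pos x).2 (by simpa using hx)
    obtain ⟨t, h0, hz, hs⟩ := h1
    have hs' : ∑ i, t i = 1 := by
      have := congrFun hs 0
      simpa [hvec, Finset.sum_apply] using this
    have hx' : ∑ i, t i • u i = x := by
      ext k
      have := congrFun hs k.succ
      simpa [hvec, Finset.sum_apply] using this
    have hsum : ∑ i, t i * (dotR c (u i) - μ) = 0 := by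
      simp only [mul_sub, Finset.sum_sub_distrib]
      rw [← dotR_sum, hx', ← Finset.sum_mul, hs', hxμ]; ring
    have hnn : ∀ i ∈ Finset.univ, 0 ≤ t i * (dotR c (u i) - μ) := by
      intro i _
      by_cases hi : i ∈ S
      · exact mul_nonneg (h0 i) (sub_nonneg.2 (hμ i hi))
      · simp [hz i hi]
    have hall := (Finset.sum_eq_zero_iff_of_nonneg hnn).1 hsum
    have h2 := (cone_slice u T 1 one_pos x).1 ⟨t, h0, ?_, hs⟩
    · simpa using h2
    · intro i hi
      by_cases hiS : i ∈ S
      · rcases mul_eq_zero.1 (hall i (Finset.mem_univ i)) with h | h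
        · exact h
        · exact absurd ((hT i).2 ⟨hiS, sub_eq_zero.1 h⟩) hi
      · exact hz i hiS
  · intro hx
    refine ⟨convexHull_mono (Set.image_mono (by exact_mod_cast hTS)) hx, fun y hy => ?_⟩
    rw [heq x hx]; exact hge y hy

lemma face_even {ι : Type*} [Fintype ι] {n k : ℕ} (u : ι → Fin n → ℝ) (hu : ∀ i, IsIntPt (u i))
    (S : Finset ι)
    (hcls : ∀ F, IsFace (convexHull ℝ (u '' S)) F → 2 ^ k ≤ polyDim F → EvenVol F)
    (c : Fin n → ℝ) (μ : ℝ) (hμ : ∀ i ∈ S, μ ≤ dotR c (u i)) (A : Finset ι)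
    (hA : ∀ i, i ∈ A ↔ i ∈ S ∧ dotR c (u i) = μ) (F : Finset ι)
    (hF : IsCF (fun i => hvec (u i)) A F) (a : ℕ) (ψ : (Fin a → ℝ) →ₗ[ℝ] (Fin (n+1) → ℝ))
    (hψ : LChart (Submodule.span ℝ ((fun i => hvec (u i)) '' F)) ψ) (ha : 2 ^ k + 1 ≤ a) :
    ∃ m : ℕ, cvol (hht n) ψ (wcone (fun i => hvec (u i)) F) = 2 * m := by
  classical
  have hFn : F.Nonempty := by
    by_contra hne
    rw [Finset.not_nonempty_iff_eq_empty] at hne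
    subst hne
    have h1 := LinearMap.finrank_range_of_inj hψ.1
    rw [hψ.2.1] at h1
    rw [Finset.coe_empty, Set.image_empty, Submodule.span_empty, finrank_bot,
      Module.finrank_fin_fun] at h1
    rw [← h1] at ha
    exact absurd ha (Nat.not_succ_le_zero _)
  obtain ⟨c', hc', hF'⟩ := hF
  obtain ⟨β, c1, hc1⟩ := lin_hvec c'
  simp only [hc1] at hc' hF'
  set K : ℝ := ∑ i, |β + dotR c1 (u i)| / |dotR c (u i) - μ| + 1 with hK
  have hKi : ∀ i, |β + dotR c1 (u i)| / |dotR c (u i) - μ| < K := by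
    intro i
    have := Finset.single_le_sum (f := fun i => |β + dotR c1 (u i)| / |dotR c (u i) - μ|)
      (fun i _ => by positivity) (Finset.mem_univ i)
    linarith
  have hgap : ∀ i ∈ S, i ∉ A → K * μ - β < dotR (K • c + c1) (u i) := by
    intro i hi hiA
    have hpos : 0 < dotR c (u i) - μ := by
      rcases (hμ i hi).lt_or_eq with h | h
      · linarith
      · exact absurd ((hA i).2 ⟨hi, h.symm⟩) hiA
    have h1 := hKi i
    rw [abs_of_pos hpos, div_lt_iff₀ hpos] at h1
    have h2 := neg_abs_le (β + dotR c1 (u i))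
    rw [dotR_comb_left]
    nlinarith
  have hface : argminSet (K • c + c1) (convexHull ℝ (u '' (S : Set ι))) =
      convexHull ℝ (u '' (F : Set ι)) := by
    refine argmin_hull u S F (K • c + c1) (K * μ - β) ?_ ?_ hFn
    · intro i hi
      by_cases hiA : i ∈ A
      · have := hc' i hiA
        rw [dotR_comb_left, ((hA i).1 hiA).2]; linarith
      · exact (hgap i hi hiA).le
    · intro i
      rw [hF']
      constructor
      · rintro ⟨hiA, h⟩
        refine ⟨((hA i).1 hiA).1, ?_⟩
        rw [dotR_comb_left, ((hA i).1 hiA).2]; linarith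
      · rintro ⟨hiS, h⟩
        have hiA : i ∈ A := by
          by_contra hiA
          exact absurd h (hgap i hiS hiA).ne'
        refine ⟨hiA, ?_⟩
        rw [dotR_comb_left, ((hA i).1 hiA).2] at h; linarith
  have hdim := link_dim u hu F hFn a ψ hψ
  refine even_of_link u hu F hFn (hcls _ (Or.inr ⟨_, hface.symm⟩) (by omega)) a ψ hψ

theorem main_indexed {ι : Type*} [Fintype ι] {n k : ℕ} (u : ι → Fin n → ℝ)
    (hu : ∀ i, IsIntPt (u i)) (S1 S2 S : Finset ι) (hdis : Disjoint S1 S2)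
    (hS : ∀ i, i ∈ S ↔ i ∈ S1 ∨ i ∈ S2) (hSn : S.Nonempty)
    (h1 : ∀ F, IsFace (convexHull ℝ (u '' S1)) F → 2 ^ k ≤ polyDim F → EvenVol F)
    (h2 : ∀ F, IsFace (convexHull ℝ (u '' S2)) F → 2 ^ k ≤ polyDim F → EvenVol F) :
    ∀ F, IsFace (convexHull ℝ (u '' S)) F → 2 ^ (k+1) ≤ polyDim F → EvenVol F := by
  classical
  rintro F (rfl | ⟨c, rfl⟩) hd
  · exfalso
    have : polyDim (∅ : Set (Fin n → ℝ)) = 0 := by simp [polyDim]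
    rw [this] at hd
    have : 0 < 2 ^ (k+1) := by positivity
    omega
  obtain ⟨i0, hi0, hmin⟩ := Finset.exists_min_image S (fun i => dotR c (u i)) hSn
  set μ := dotR c (u i0) with hμ
  set T := S.filter (fun i => dotR c (u i) = μ) with hT
  have hTn : T.Nonempty := ⟨i0, by simp [hT, hi0, hμ]⟩
  have hface := argmin_hull u S T c μ hmin (fun i => by simp [hT]) hTn
  rw [hface] at hd ⊢
  set A := S1.filter (fun i => dotR c (u i) = μ) with hA
  set B := S2.filter (fun i => dotR c (u i) = μ) with hB
  refine link_even u hu T hTn fun ψ hψ => ?_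
  have hint := integrality (hht n) (fun i => hvec (u i)) (fun i => isInt_hvec _ (hu i))
    (fun i => hht_hvec _) (link_sing u hu)
  have hpow : 2 ^ (k+1) = 2 ^ k + 2 ^ k := by ring
  have := core (hht n) (fun i => hvec (u i)) (fun i => isInt_hvec _ (hu i))
    (fun i => hht_hvec _) A B T
    (Finset.disjoint_filter_filter hdis) (fun i => by simp [hT, hA, hB, hS]; tauto) 2 ?_ ψ hψ
  · simpa using this
  intro F G _ _ hF hG a b ψF ψG hψF hψG hab
  by_cases hcase : 2 ^ k + 1 ≤ a
  · obtain ⟨m, hm⟩ := face_even u hu S1 h1 c μ (fun i hi => hmin i ((hS i).2 (Or.inl hi))) A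
      (fun i => by simp [hA]) F hF a ψF hψF hcase
    obtain ⟨m', hm'⟩ := hint G b ψG hψG
    refine ⟨m * m', ?_⟩
    rw [hm, hm']; push_cast; ring
  · obtain ⟨m, hm⟩ := face_even u hu S2 h2 c μ (fun i hi => hmin i ((hS i).2 (Or.inr hi))) B
      (fun i => by simp [hB]) G hG b ψG hψG (by omega)
    obtain ⟨m', hm'⟩ := hint F a ψF hψF
    refine ⟨m * m', ?_⟩
    rw [hm, hm']; push_cast; ring

theorem main_thm {n : ℕ} (k : ℕ) (P Q : Set (Fin n → ℝ))
    (hP : InQclass k P) (hQ : InQclass k Q) :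
    InQclass (k + 1) (convexHull ℝ (P ∪ Q)) := by
  classical
  obtain ⟨⟨V1, hV1, rfl⟩, hP⟩ := hP
  obtain ⟨⟨V2, hV2, rfl⟩, hQ⟩ := hQ
  set g : (Fin n → ℤ) → (Fin n → ℝ) := fun v (i : Fin n) => ((v i : ℤ) : ℝ) with hg
  have hR : convexHull ℝ (convexHull ℝ (g '' (V1 : Set (Fin n → ℤ))) ∪
      convexHull ℝ (g '' (V2 : Set (Fin n → ℤ)))) =
      convexHull ℝ (g '' ((V1 ∪ V2 : Finset (Fin n → ℤ)) : Set (Fin n → ℤ))) := by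
    rw [convexHull_convexHull_union_left, convexHull_convexHull_union_right, Finset.coe_union,
      Set.image_union]
  rw [hR]
  refine ⟨⟨V1 ∪ V2, hV1.mono Finset.subset_union_left, rfl⟩, ?_⟩
  let u : V1 ⊕ V2 → Fin n → ℝ := Sum.elim (fun v => g v) (fun v => g v)
  have hu : ∀ i, IsIntPt (u i) := by
    rintro (v | v) <;> exact fun j => ⟨_, rfl⟩
  set S1 : Finset (V1 ⊕ V2) := Finset.univ.filter (fun i => i.isLeft) with hS1
  set S2 : Finset (V1 ⊕ V2) := Finset.univ.filter (fun i => i.isRight) with hS2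
  have e1 : u '' S1 = g '' (V1 : Set (Fin n → ℤ)) := by
    ext x; simp [hS1, u]
  have e2 : u '' S2 = g '' (V2 : Set (Fin n → ℤ)) := by
    ext x; simp [hS2, u]
  have e3 : u '' ((Finset.univ : Finset (V1 ⊕ V2)) : Set (V1 ⊕ V2)) =
      g '' ((V1 ∪ V2 : Finset (Fin n → ℤ)) : Set (Fin n → ℤ)) := by
    rw [Finset.coe_union, Set.image_union, ← e1, ← e2, ← Set.image_union]
    congr 1
    ext i; cases i <;> simp [hS1, hS2]
  rw [← e3]
  refine main_indexed u hu S1 S2 Finset.univ ?_ ?_ ?_ (by rw [e1]; exact hP) (by rw [e2]; exact hQ)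
  · rw [Finset.disjoint_left]
    rintro (i | i) <;> simp [hS1, hS2]
  · rintro (i | i) <;> simp [hS1, hS2]
  · obtain ⟨v, hv⟩ := hV1
    exact ⟨Sum.inl ⟨v, hv⟩, Finset.mem_univ _⟩

/-- If `P, Q ∈ Q_k`, then `conv(P ∪ Q) ∈ Q_{k+1}`. -/
theorem convexHull_union_mem_Qk_succ {n : ℕ} (k : ℕ) (P Q : Set (Fin n → ℝ))
    (hP : InQclass k P) (hQ : InQclass k Q) :
    InQclass (k + 1) (convexHull ℝ (P ∪ Q)) := by
  exact main_thm k P Q hP hQ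

end
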